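/- Theorem of Hudson and Pan: let n ≥ 3. Every set of group generators of the Cremona group Bir(ℙⁿ_ℂ) contains uncountably many elements that are not linear automorphisms: if S ⊆ Aut_ℂ(ℂ(x₁,…,xₙ)) generates Aut_ℂ(ℂ(x₁,…,xₙ)) as a group, then the set of elements of S that are not linear (projective) automorphisms is uncountable. -/

import Mathlib

set_option autoImplicit false

noncomputable section

/-- The field `ℂ(x₁,…,xₙ)` of rational functions in `n` variables over `ℂ`. -/
abbrev Kn (n : ℕ) : Type := FractionRing (MvPolynomial (Fin n) ℂ)

/-- The Cremona group `Bir(ℙⁿ_ℂ)`, identified with `Aut_ℂ(ℂ(x₁,…,xₙ))`. -/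
abbrev CremonaN (n : ℕ) : Type := Kn n ≃ₐ[ℂ] Kn n

/-- The coordinate function `x_i`. -/
def Xv (n : ℕ) (i : Fin n) : Kn n :=
  algebraMap (MvPolynomial (Fin n) ℂ) (Kn n) (MvPolynomial.X i)

/-- The degree-one rational function `a_{r0} + Σ_{j=1}^n a_{rj} x_j` attached to the row `r`
of an `(n+1)×(n+1)` matrix `A` (indices `0,…,n`, index `0` being the constant term). -/
def affForm (n : ℕ) (A : Matrix (Fin (n + 1)) (Fin (n + 1)) ℂ) (r : Fin (n + 1)) : Kn n :=
  algebraMap ℂ (Kn n) (A r 0) + ∑ j : Fin n, algebraMap ℂ (Kn n) (A r j.succ) * Xv n j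

/-- `f ∈ Bir(ℙⁿ_ℂ)` is a linear (projective) automorphism: there is an invertible
`(n+1)×(n+1)` complex matrix `A = (a_{ij})_{0 ≤ i,j ≤ n}` such that
`f(x_i) = (a_{i0} + Σ_j a_{ij}x_j)/(a_{00} + Σ_j a_{0j}x_j)` for all `1 ≤ i ≤ n`. -/
def IsLinearAutN (n : ℕ) (f : CremonaN n) : Prop :=
  ∃ A : Matrix (Fin (n + 1)) (Fin (n + 1)) ℂ, IsUnit A ∧
    ∀ i : Fin n, f (Xv n i) = affForm n A i.succ / affForm n A 0

namespace HudsonPan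

section Taylor

variable {F : Type*} [Field F]

/-- The Taylor series `∑ Dⁿ(a)/n! tⁿ` attached to a derivation `D`. -/
def taylorSeries (D : Derivation ℤ F F) (a : F) : PowerSeries F :=
  PowerSeries.mk fun n => D^[n] a / (n.factorial : F)

theorem coeff_taylorSeries (D : Derivation ℤ F F) (a : F) (n : ℕ) :
    PowerSeries.coeff n (taylorSeries D a) = D^[n] a / (n.factorial : F) := by
  simp [taylorSeries]

theorem constantCoeff_taylorSeries (D : Derivation ℤ F F) (a : F) :
    PowerSeries.constantCoeff (taylorSeries D a) = a := by
  rw [← PowerSeries.coeff_zero_eq_constantCoeff_apply, coeff_taylorSeries]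
  simp

theorem taylorSeries_add (D : Derivation ℤ F F) (a b : F) :
    taylorSeries D (a + b) = taylorSeries D a + taylorSeries D b := by
  ext n
  simp [coeff_taylorSeries, add_div]

variable [CharZero F]

theorem derivative_taylorSeries (D : Derivation ℤ F F) (a : F) :
    PowerSeries.derivative F (taylorSeries D a) = taylorSeries D (D a) := by
  ext n
  rw [PowerSeries.coeff_derivative, coeff_taylorSeries, coeff_taylorSeries,
    Function.iterate_succ_apply, Nat.factorial_succ]
  have h1 : (n.factorial : F) ≠ 0 := by exact_mod_cast n.factorial_ne_zero
  have h2 : ((n : F) + 1) ≠ 0 := by exact_mod_cast n.succ_ne_zero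
  push_cast
  field_simp

theorem taylorSeries_mul (D : Derivation ℤ F F) (a b : F) :
    taylorSeries D (a * b) = taylorSeries D a * taylorSeries D b := by
  ext n
  induction n generalizing a b with
  | zero =>
    simp only [PowerSeries.coeff_zero_eq_constantCoeff, map_mul, constantCoeff_taylorSeries]
  | succ n ih =>
    have h2 : ((n : F) + 1) ≠ 0 := by exact_mod_cast n.succ_ne_zero
    apply mul_right_cancel₀ h2
    rw [← PowerSeries.coeff_derivative, ← PowerSeries.coeff_derivative, Derivation.leibniz,
      derivative_taylorSeries, derivative_taylorSeries, derivative_taylorSeries,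
      Derivation.leibniz, taylorSeries_add, map_add, map_add]
    simp only [smul_eq_mul, ih]

theorem taylorSeries_pow (D : Derivation ℤ F F) (d a : F) (n : ℕ) :
    taylorSeries D d * taylorSeries D a ^ n = taylorSeries D (d * a ^ n) := by
  induction n with
  | zero => simp
  | succ n ih => rw [pow_succ, pow_succ, ← mul_assoc, ih, ← taylorSeries_mul, mul_assoc]

variable {k : Type*} [Field k] [Algebra k F]

/-- The key step of Seidenberg's theorem: a derivation preserving `R` preserves the property of
being almost integral over `R`. -/
theorem mul_mul_derivation_pow_mem (D : Derivation ℤ F F) (R : Subalgebra k F)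
    (hD : ∀ x ∈ R, D x ∈ R) (d a : F) (h : ∀ n, d * a ^ n ∈ R) (n : ℕ) :
    d * d * D a ^ n ∈ R := by
  have hit : ∀ m, ∀ x ∈ R, D^[m] x ∈ R := by
    intro m
    induction m with
    | zero => intro x hx; exact hx
    | succ m ih => intro x hx; rw [Function.iterate_succ_apply]; exact ih _ (hD x hx)
  have hcoeff : ∀ m, ∀ x ∈ R, PowerSeries.coeff m (taylorSeries D x) ∈ R := by
    intro m x hx
    rw [coeff_taylorSeries, div_eq_mul_inv]
    refine R.mul_mem (hit m x hx) ?_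
    have : ((m.factorial : F))⁻¹ = algebraMap k F ((m.factorial : k))⁻¹ := by simp
    rw [this]
    exact R.algebraMap_mem _
  obtain ⟨ψ, hψ⟩ : (PowerSeries.X : PowerSeries F) ∣
      taylorSeries D a - PowerSeries.C a := by
    rw [PowerSeries.X_dvd_iff, map_sub, constantCoeff_taylorSeries]
    simp
  have hψ0 : PowerSeries.constantCoeff ψ = D a := by
    have := congrArg (PowerSeries.coeff 1) hψ
    rw [PowerSeries.coeff_succ_X_mul 0, map_sub, coeff_taylorSeries] at this
    simpa [PowerSeries.coeff_C] using this.symm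
  have key : PowerSeries.coeff n (PowerSeries.C d * (taylorSeries D d *
      (taylorSeries D a - PowerSeries.C a) ^ n)) = d * d * D a ^ n := by
    rw [hψ, mul_pow, PowerSeries.coeff_C_mul, mul_left_comm, PowerSeries.coeff_X_pow_mul',
      if_pos le_rfl, Nat.sub_self, PowerSeries.coeff_zero_eq_constantCoeff_apply, map_mul,
      map_pow, hψ0, constantCoeff_taylorSeries, mul_assoc]
  rw [← key, sub_eq_add_neg, add_pow, Finset.mul_sum, Finset.mul_sum, map_sum]
  refine R.sum_mem fun m _ => ?_
  have : PowerSeries.C d * (taylorSeries D d * (taylorSeries D a ^ m *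
      (-PowerSeries.C a) ^ (n - m) * ((n.choose m : ℕ) : PowerSeries F))) =
      PowerSeries.C ((-1) ^ (n - m) * (n.choose m : F) * (d * a ^ (n - m))) *
        taylorSeries D (d * a ^ m) := by
    rw [← taylorSeries_pow, neg_pow]
    simp only [map_mul, map_pow, map_neg, map_one, map_natCast]
    ring
  rw [this, PowerSeries.coeff_C_mul]
  refine R.mul_mem (R.mul_mem (R.mul_mem (R.pow_mem (R.neg_mem R.one_mem) _) ?_) (h _))
    (hcoeff _ _ (h _))
  exact natCast_mem R _

end Taylor

section Valuation

variable {F : Type*} [Field F]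

open Polynomial

theorem aeval_mem_valuationSubring {B : Type*} [CommRing B] [Algebra B F] (V : ValuationSubring F)
    (hV : ∀ b : B, algebraMap B F b ∈ V) {a : F} (ha : a ∈ V) (p : B[X]) : aeval a p ∈ V := by
  rw [aeval_eq_sum_range]
  refine sum_mem fun i _ => ?_
  rw [Algebra.smul_def]
  exact mul_mem (hV _) (pow_mem ha i)

theorem mem_valuationSubring_of_isIntegral {B : Type*} [CommRing B] [Algebra B F]
    (V : ValuationSubring F) (hV : ∀ b : B, algebraMap B F b ∈ V) {a : F} (ha : IsIntegral B a) :
    a ∈ V := by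
  let φ : B →+* V := (algebraMap B F).codRestrict V.toSubring hV
  let _ : Algebra B V := φ.toAlgebra
  have _ : IsScalarTower B V F := IsScalarTower.of_algebraMap_eq fun _ => rfl
  obtain ⟨y, hy⟩ := IsIntegrallyClosed.isIntegral_iff.mp (ha.tower_top (A := V))
  rw [← hy]
  exact y.2

theorem isIntegral_of_forall_mem_valuationSubring {B : Type*} [CommRing B] [Algebra B F] {a : F}
    (h : ∀ V : ValuationSubring F, (∀ b : B, algebraMap B F b ∈ V) → a ∈ V) : IsIntegral B a := by
  have h1 : a ∈ (⨅ V : {V : ValuationSubring F // Set.range (algebraMap B F) ⊆ V.toSubring},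
      V.1.toSubring) := by
    rw [Subring.mem_iInf]
    intro V
    exact h V.1 fun b => V.2 ⟨b, rfl⟩
  rw [iInf_valuationSubring_superset] at h1
  have h2 : IsIntegral (Subring.closure (Set.range (algebraMap B F))) a := h1
  have h3 : Subring.closure (Set.range (algebraMap B F)) = (algebraMap B F).range := by
    rw [← RingHom.coe_range, Subring.closure_eq]
  rw [h3] at h2
  obtain ⟨p, hp, hpa⟩ := h2
  have hsurj : Function.Surjective (algebraMap B F).rangeRestrict :=
    (algebraMap B F).rangeRestrict_surjective
  have hlift : p ∈ Polynomial.lifts (algebraMap B F).rangeRestrict :=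
    (Polynomial.mem_lifts p).mpr (Polynomial.map_surjective _ hsurj p)
  obtain ⟨q, hq, -, hqm⟩ := Polynomial.lifts_and_natDegree_eq_and_monic hlift hp
  refine ⟨q, hqm, ?_⟩
  rw [← hq, eval₂_map] at hpa
  exact hpa

/-- An element of a valuation ring `V`, algebraic over a principal ideal domain `B ⊆ V`, is a
quotient of elements integral over `B` with denominator a unit of `V`. -/
theorem exists_integral_denominator {B : Type*} [CommRing B] [IsDomain B]
    [IsPrincipalIdealRing B] [Algebra B F] [FaithfulSMul B F] (V : ValuationSubring F)
    (hV : ∀ b : B, algebraMap B F b ∈ V) {a : F} (haV : a ∈ V) (ha : IsAlgebraic B a) :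
    ∃ c : F, IsIntegral B c ∧ IsIntegral B (a * c) ∧ V.valuation c = 1 := by
  classical
  let _ : NormalizationMonoid B := Classical.arbitrary _
  let _ := UniqueFactorizationMonoid.toNormalizedGCDMonoid B
  obtain ⟨p, hprim, hpa⟩ : ∃ p : B[X], p.IsPrimitive ∧ aeval a p = 0 := by
    obtain ⟨p, hp, hpa⟩ := ha
    refine ⟨p.primPart, p.isPrimitive_primPart, ?_⟩
    rw [p.eq_C_content_mul_primPart, map_mul, aeval_C] at hpa
    refine (mul_eq_zero.mp hpa).resolve_left ?_
    rw [← ne_eq, map_ne_zero_iff _ (FaithfulSMul.algebraMap_injective B F)]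
    exact mt content_eq_zero_iff.mp hp
  set h : ℕ → F := fun j => aeval a (divX^[j] p) with hh
  have h0 : h 0 = 0 := hpa
  have hrec : ∀ j, h j = h (j + 1) * a + algebraMap B F ((divX^[j] p).coeff 0) := by
    intro j
    simp only [hh, Function.iterate_succ_apply']
    conv_lhs => rw [← divX_mul_X_add (divX^[j] p)]
    simp
  have hmem : ∀ (W : ValuationSubring F), (∀ b : B, algebraMap B F b ∈ W) →
      ∀ j, h (j + 1) ∈ W ∧ a * h (j + 1) ∈ W := by
    intro W hW
    have key : (∀ j, h j ∈ W) → ∀ j, h (j + 1) ∈ W ∧ a * h (j + 1) ∈ W := by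
      intro hj j
      refine ⟨hj _, ?_⟩
      have : a * h (j + 1) = h j - algebraMap B F ((divX^[j] p).coeff 0) := by
        rw [hrec j]; ring
      rw [this]
      exact sub_mem (hj _) (hW _)
    apply key
    by_cases haW : a ∈ W
    · exact fun j => aeval_mem_valuationSubring W hW haW _
    · have hai : a⁻¹ ∈ W := (W.mem_or_inv_mem a).resolve_left haW
      have ha0 : a ≠ 0 := fun h => haW (h ▸ W.zero_mem)
      intro j
      induction j with
      | zero => rw [h0]; exact W.zero_mem
      | succ j ih =>
        have : h (j + 1) = (h j - algebraMap B F ((divX^[j] p).coeff 0)) * a⁻¹ := by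
          rw [hrec j]; field_simp; ring
        rw [this]
        exact mul_mem (sub_mem ih (hW _)) hai
  obtain ⟨j, hj⟩ : ∃ j, V.valuation (h (j + 1)) = 1 := by
    by_contra! hcon
    have hlt : ∀ j, V.valuation (h (j + 1)) < 1 := fun j =>
      lt_of_le_of_ne ((V.valuation_le_one_iff _).mpr (hmem V hV j).1) (hcon j)
    have hlt' : ∀ j, V.valuation (h j) < 1 := by
      rintro (_ | j)
      · rw [h0, map_zero]; exact zero_lt_one
      · exact hlt j
    let φ : B →+* V := (algebraMap B F).codRestrict V.toSubring hV
    let P : Ideal B := (IsLocalRing.maximalIdeal V).comap φ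
    have hP : ∀ b : B, b ∈ P ↔ V.valuation (algebraMap B F b) < 1 := fun b =>
      V.valuation_lt_one_iff (φ b)
    have hcoef : ∀ i, p.coeff i ∈ P := by
      intro i
      have hci : (divX^[i] p).coeff 0 = p.coeff i := by
        have : ∀ (i m : ℕ), (divX^[i] p).coeff m = p.coeff (m + i) := by
          intro i
          induction i with
          | zero => intro m; rfl
          | succ i ih => intro m; rw [Function.iterate_succ_apply', coeff_divX, ih]; congr 1; ring
        simpa using this i 0
      rw [hP, ← hci, show algebraMap B F ((divX^[i] p).coeff 0) = h i - h (i + 1) * a by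
        rw [hrec i]; ring]
      refine lt_of_le_of_lt (Valuation.map_sub _ _ _) (max_lt (hlt' _) ?_)
      rw [map_mul]
      exact mul_lt_one_of_lt_of_le (hlt _) ((V.valuation_le_one_iff _).mpr haV)
    obtain ⟨g, hg⟩ := (IsPrincipalIdealRing.principal P).principal
    have hgdvd : C g ∣ p := by
      rw [C_dvd_iff_dvd_coeff]
      intro i
      have := hcoef i
      rw [hg] at this
      exact Ideal.mem_span_singleton.mp this
    have hgu := hprim g hgdvd
    have hgP : g ∈ P := by rw [hg]; exact Ideal.mem_span_singleton_self g
    have : (1 : B) ∈ P := by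
      rw [Ideal.eq_top_of_isUnit_mem _ hgP hgu]; trivial
    rw [hP, map_one, map_one] at this
    exact lt_irrefl _ this
  exact ⟨h (j + 1), isIntegral_of_forall_mem_valuationSubring fun W hW => (hmem W hW j).1,
    isIntegral_of_forall_mem_valuationSubring fun W hW => (hmem W hW j).2, hj⟩

end Valuation

section DimensionOne

open Polynomial

variable {k F : Type*} [Field k] [Field F] [Algebra k F]

theorem adjoin_singleton_isPrincipalIdealRing (t : F) :
    IsPrincipalIdealRing (Algebra.adjoin k {t}) := by
  rw [Algebra.adjoin_singleton_eq_range_aeval]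
  exact IsPrincipalIdealRing.of_surjective (aeval (R := k) t).rangeRestrict
    (aeval (R := k) t).rangeRestrict_surjective

theorem algebraMap_valuation_eq_one (V : ValuationSubring F) (hV : ∀ c : k, algebraMap k F c ∈ V)
    {c : k} (hc : c ≠ 0) : V.valuation (algebraMap k F c) = 1 := by
  refine le_antisymm ((V.valuation_le_one_iff _).mpr (hV c)) ?_
  have h1 := (V.valuation_le_one_iff _).mpr (hV c⁻¹)
  have h2 : V.valuation (algebraMap k F c) * V.valuation (algebraMap k F c⁻¹) = 1 := by
    rw [← map_mul, ← map_mul, mul_inv_cancel₀ hc, map_one, map_one]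
  calc (1 : V.ValueGroup) = V.valuation (algebraMap k F c) * V.valuation (algebraMap k F c⁻¹) :=
        h2.symm
    _ ≤ V.valuation (algebraMap k F c) * 1 := by gcongr
    _ = _ := mul_one _

theorem exists_valuation_aeval_eq_pow (V : ValuationSubring F)
    (hV : ∀ c : k, algebraMap k F c ∈ V) {t : F} (ht : V.valuation t < 1) {P : k[X]}
    (hP : P ≠ 0) : ∃ j : ℕ, V.valuation (aeval t P) = V.valuation t ^ j := by
  obtain ⟨Q, hQ, hnd⟩ := Polynomial.exists_eq_pow_rootMultiplicity_mul_and_not_dvd P hP 0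
  refine ⟨P.rootMultiplicity 0, ?_⟩
  have htV : t ∈ V := (V.valuation_le_one_iff _).mp ht.le
  rw [C_0, sub_zero] at hQ hnd
  have hQ0 : Q.coeff 0 ≠ 0 := fun h => hnd (X_dvd_iff.mpr h)
  have hQ1 : V.valuation (aeval t Q) = 1 := by
    have h1 : aeval t Q = algebraMap k F (Q.coeff 0) + aeval t Q.divX * t := by
      conv_lhs => rw [← divX_mul_X_add Q]
      simp [add_comm]
    rw [h1, Valuation.map_add_eq_of_lt_left]
    · exact algebraMap_valuation_eq_one V hV hQ0
    · rw [algebraMap_valuation_eq_one V hV hQ0, map_mul]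
      exact mul_lt_one_of_nonneg_of_lt_one_right ((V.valuation_le_one_iff _).mpr
        (aeval_mem_valuationSubring V hV htV _)) zero_le ht
  conv_lhs => rw [hQ]
  rw [map_mul, map_mul, hQ1, mul_one, map_pow, map_pow, aeval_X]

/-- Valuation rings of a function field of one variable have rank one. -/
theorem mem_of_forall_mul_pow_mem
    (hdim : ∀ t a : F, Transcendental k t → IsAlgebraic (Algebra.adjoin k {t}) a)
    (V : ValuationSubring F) (hV : ∀ c : k, algebraMap k F c ∈ V) {e y : F} (he : e ≠ 0)
    (h : ∀ n : ℕ, e * y ^ n ∈ V) : y ∈ V := by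
  by_contra hy
  have hy0 : y ≠ 0 := fun h => hy (h ▸ V.zero_mem)
  have heV : e ∈ V := by simpa using h 0
  have htlt : V.valuation y⁻¹ < 1 := by
    rw [map_inv₀]
    apply inv_lt_one_of_one_lt₀
    rw [← not_le, V.valuation_le_one_iff]
    exact hy
  have htV : y⁻¹ ∈ V := (V.valuation_le_one_iff _).mp htlt.le
  have htr : Transcendental k y⁻¹ := by
    intro halg
    refine hy (mem_valuationSubring_of_isIntegral (B := k) V hV ?_)
    have := halg.inv
    rw [inv_inv] at this
    exact this.isIntegral
  have hA : ∀ b : Algebra.adjoin k {y⁻¹}, algebraMap _ F b ∈ V := by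
    rintro ⟨b, hb⟩
    rw [Algebra.adjoin_singleton_eq_range_aeval] at hb
    obtain ⟨P, rfl⟩ := hb
    exact aeval_mem_valuationSubring V hV htV P
  obtain ⟨q, hq0, hq⟩ := (hdim _ e htr).exists_nonzero_coeff_and_aeval_eq_zero
    (mem_nonZeroDivisors_of_ne_zero he)
  obtain ⟨⟨b, hb⟩, hbq⟩ : ∃ b, b = q.coeff 0 := ⟨_, rfl⟩
  have hb' := hb
  rw [Algebra.adjoin_singleton_eq_range_aeval] at hb'
  obtain ⟨P, hP⟩ := hb'
  have hP0 : P ≠ 0 := by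
    rintro rfl
    apply hq0
    rw [← hbq]
    exact Subtype.ext (by simpa using hP.symm)
  obtain ⟨j, hj⟩ := exists_valuation_aeval_eq_pow V hV htlt hP0
  have hval : V.valuation b = V.valuation y⁻¹ ^ j := by
    rw [← hj]; exact congrArg _ hP.symm
  have hbe : b = -(aeval e q.divX) * e := by
    rw [← divX_mul_X_add q, map_add, map_mul, aeval_X, aeval_C, ← hbq] at hq
    exact eq_neg_of_add_eq_zero_right hq |>.trans (by ring)
  have hle : V.valuation b ≤ V.valuation e := by
    rw [hbe, map_mul, Valuation.map_neg]
    exact mul_le_of_le_one_left' ((V.valuation_le_one_iff _).mpr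
      (aeval_mem_valuationSubring V hA heV _))
  have hle2 : V.valuation e ≤ V.valuation y⁻¹ ^ (j + 1) := by
    have h1 := (V.valuation_le_one_iff _).mpr (h (j + 1))
    have h2 : e = (e * y ^ (j + 1)) * y⁻¹ ^ (j + 1) := by
      rw [inv_pow, mul_assoc, mul_inv_cancel₀ (pow_ne_zero _ hy0), mul_one]
    rw [h2, map_mul, map_pow]
    exact mul_le_of_le_one_left' h1
  have hpos : 0 < V.valuation y⁻¹ ^ j := by
    apply pow_pos
    rw [zero_lt_iff, Valuation.ne_zero_iff]
    exact inv_ne_zero hy0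
  have : V.valuation y⁻¹ ^ j ≤ V.valuation y⁻¹ ^ (j + 1) := hval ▸ hle.trans hle2
  rw [pow_succ] at this
  exact absurd this (not_le.mpr (mul_lt_of_lt_one_right hpos htlt))

theorem exists_mul_pow_mem_of_isIntegral {A R : Subalgebra k F} (hAR : A ≤ R)
    (hfrac : ∀ f : F, ∃ r ∈ R, ∃ s ∈ R, f = r / s) {b : F} (hb : IsIntegral A b) :
    ∃ d : F, d ≠ 0 ∧ ∀ n : ℕ, d * b ^ n ∈ R := by
  have hbR : IsIntegral R b := by
    let _ : Algebra A R := (Subalgebra.inclusion hAR).toAlgebra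
    have _ : IsScalarTower A R F := IsScalarTower.of_algebraMap_eq fun _ => rfl
    exact hb.tower_top
  have hsm : ∃ t ∈ nonZeroDivisors R, t • b ∈ (algebraMap R F).range := by
    obtain ⟨r, hr, s, hs, rfl⟩ := hfrac b
    by_cases hs0 : s = 0
    · exact ⟨1, one_mem _, ⟨0, by simp [hs0]⟩⟩
    · refine ⟨⟨s, hs⟩, mem_nonZeroDivisors_of_ne_zero fun h => hs0 (congrArg Subtype.val h),
        ⟨⟨r, hr⟩, ?_⟩⟩
      rw [Algebra.smul_def, Subalgebra.algebraMap_def, Subalgebra.algebraMap_def]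
      exact (mul_div_cancel₀ r hs0).symm
  obtain ⟨d, hd, hdn⟩ := hbR.isAlmostIntegral_of_exists_smul_mem_range hsm
  refine ⟨d, fun h => nonZeroDivisors.ne_zero hd (Subtype.ext h), fun n => ?_⟩
  obtain ⟨r, hr⟩ := hdn n
  rw [Algebra.smul_def, Subalgebra.algebraMap_def, Subalgebra.algebraMap_def] at hr
  exact hr ▸ r.2

/-- On a function field of one variable over `k`, generated by constants of a derivation `D`
preserving `k`, the derivation `D` preserves all the valuation rings containing `k`. -/
theorem derivation_mem_valuationSubring [CharZero F] (D : Derivation ℤ F F)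
    (hDk : ∀ c : k, D (algebraMap k F c) ∈ (algebraMap k F).range)
    {z : Set F} (hz : ∀ x ∈ z, D x = 0) (hgen : IntermediateField.adjoin k z = ⊤)
    (hdim : ∀ t a : F, Transcendental k t → IsAlgebraic (Algebra.adjoin k {t}) a)
    (hne : ∃ t : F, Transcendental k t)
    (V : ValuationSubring F) (hV : ∀ c : k, algebraMap k F c ∈ V) {a : F} (ha : a ∈ V) :
    D a ∈ V := by
  have hDinv : ∀ x, D x = 0 → D x⁻¹ = 0 := by
    intro x hx
    rw [Derivation.leibniz_inv, hx, smul_zero]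
  set w : Set F := {x | x ∈ V ∧ D x = 0} with hw
  set R := Algebra.adjoin k w with hR
  have hRV : ∀ x ∈ R, x ∈ V := by
    intro x hx
    induction hx using Algebra.adjoin_induction with
    | mem x hx => exact hx.1
    | algebraMap c => exact hV c
    | add x y _ _ hx hy => exact add_mem hx hy
    | mul x y _ _ hx hy => exact mul_mem hx hy
  have hRD : ∀ x ∈ R, D x ∈ R := by
    intro x hx
    induction hx using Algebra.adjoin_induction with
    | mem x hx => rw [hx.2]; exact R.zero_mem
    | algebraMap c => obtain ⟨c', hc'⟩ := hDk c; rw [← hc']; exact R.algebraMap_mem c'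
    | add x y _ _ hx hy => rw [map_add]; exact add_mem hx hy
    | mul x y hx' hy' hx hy =>
      rw [Derivation.leibniz, smul_eq_mul, smul_eq_mul]
      exact add_mem (mul_mem hx' hy) (mul_mem hy' hx)
  have hwtop : IntermediateField.adjoin k w = ⊤ := by
    rw [eq_top_iff, ← hgen, IntermediateField.adjoin_le_iff]
    intro x hx
    rcases V.mem_or_inv_mem x with h | h
    · exact IntermediateField.subset_adjoin k w ⟨h, hz x hx⟩
    · have := IntermediateField.subset_adjoin k w ⟨h, hDinv x (hz x hx)⟩
      simpa using inv_mem this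
  have hfrac : ∀ f : F, ∃ r ∈ R, ∃ s ∈ R, f = r / s := by
    intro f
    have : f ∈ IntermediateField.adjoin k w := by rw [hwtop]; trivial
    exact (IntermediateField.mem_adjoin_iff_div).mp this
  obtain ⟨T, hTw, hT⟩ : ∃ T ∈ w, Transcendental k T := by
    by_contra! hcon
    obtain ⟨t, ht⟩ := hne
    apply ht
    have halg : Algebra.IsAlgebraic k (IntermediateField.adjoin k w) :=
      IntermediateField.isAlgebraic_adjoin fun x hx =>
        (not_not.mp (hcon x hx) : IsAlgebraic k x).isIntegral
    have htm : t ∈ IntermediateField.adjoin k w := by rw [hwtop]; trivial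
    exact (halg.isAlgebraic ⟨t, htm⟩).algebraMap (A := F)
  have hTR : Algebra.adjoin k {T} ≤ R :=
    Algebra.adjoin_mono (Set.singleton_subset_iff.mpr hTw)
  have hint : ∀ b : F, IsIntegral (Algebra.adjoin k {T}) b → D b ∈ V := by
    intro b hb
    obtain ⟨d, hd0, hdn⟩ := exists_mul_pow_mem_of_isIntegral hTR hfrac hb
    exact mem_of_forall_mul_pow_mem hdim V hV (mul_ne_zero hd0 hd0) fun n =>
      hRV _ (mul_mul_derivation_pow_mem D R hRD d b hdn n)
  have _ := adjoin_singleton_isPrincipalIdealRing (k := k) T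
  obtain ⟨c, hc, hac, hcV⟩ := exists_integral_denominator (B := Algebra.adjoin k {T}) V
    (fun b => hRV _ (hTR b.2)) ha (hdim T a hT)
  have hc0 : c ≠ 0 := by rintro rfl; simp at hcV
  have hcinv : c⁻¹ ∈ V := by
    rw [← V.valuation_le_one_iff, map_inv₀, hcV, inv_one]
  have hDa : D a = (D (a * c) - a * D c) * c⁻¹ := by
    rw [Derivation.leibniz, smul_eq_mul, smul_eq_mul]
    field_simp
    ring
  rw [hDa]
  exact mul_mem (sub_mem (hint _ hac) (mul_mem ha (hint _ hc))) hcinv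

end DimensionOne

section FermatCover

open Polynomial

variable {k F : Type*} [Field k] [Field F] [Algebra k F]

theorem mem_valuationSubring_of_pow_mem (V : ValuationSubring F) {a : F} {n : ℕ} (hn : 0 < n)
    (ha : a ^ n ∈ V) : a ∈ V := by
  rw [← V.valuation_le_one_iff, map_pow] at ha
  exact (V.valuation_le_one_iff a).mp ((pow_le_one_iff hn.ne').mp ha)

theorem inv_mem_of_valuation_eq_one (V : ValuationSubring F) {a : F} (ha : V.valuation a = 1) :
    a⁻¹ ∈ V := by
  rw [← V.valuation_le_one_iff, map_inv₀, ha, inv_one]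

theorem valuation_eq_one_of_pow_add_pow (V : ValuationSubring F) {a b : F} {n : ℕ} (hn : n ≠ 0)
    (ha : V.valuation a < 1) (hab : V.valuation (a ^ n + b ^ n) = 1) : V.valuation b = 1 := by
  have h1 : V.valuation (a ^ n) < 1 := by
    rw [map_pow]; exact pow_lt_one₀ zero_le ha hn
  have h2 : V.valuation (b ^ n) = 1 := by
    have : b ^ n = (a ^ n + b ^ n) - a ^ n := by ring
    rw [this, Valuation.map_sub_eq_of_lt_left, hab]
    rwa [hab]
  rw [map_pow] at h2
  exact le_antisymm ((pow_le_one_iff hn).mp h2.le) ((one_le_pow_iff hn).mp h2.ge)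

/-- A derivation as in `derivation_mem_valuationSubring` kills the coordinates of every
transcendental point of the Fermat quartic. -/
theorem derivation_eq_zero_of_fermat [CharZero F] (D : Derivation ℤ F F)
    (hpres : ∀ V : ValuationSubring F, (∀ c : k, algebraMap k F c ∈ V) → ∀ a ∈ V, D a ∈ V)
    {U v : F} (hU : Transcendental k U) (h4 : U ^ 4 + v ^ 4 = 1) : D U = 0 := by
  have hv0 : v ≠ 0 := by
    rintro rfl
    refine hU (IsIntegral.isAlgebraic (IsIntegral.of_pow (n := 4) (by norm_num) ?_))
    rw [show U ^ 4 = 1 by simpa using h4]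
    exact isIntegral_one
  have hder : U ^ 3 * D U = -(v ^ 3 * D v) := by
    have h := congrArg D h4
    rw [map_add, D.map_one_eq_zero, D.leibniz_pow, D.leibniz_pow] at h
    simp only [smul_eq_mul, nsmul_eq_mul, Nat.cast_ofNat, Nat.add_one_sub_one] at h
    have h' : (4 : F) * (U ^ 3 * D U + v ^ 3 * D v) = 0 := by linear_combination h
    rcases mul_eq_zero.mp h' with h0 | h0
    · norm_num at h0
    · linear_combination h0
  set y := D U / v ^ 3 with hy
  have hfin : ∀ V : ValuationSubring F, (∀ c : k, algebraMap k F c ∈ V) → U ∈ V → y ∈ V := by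
    intro V hV hUV
    have hvV : v ∈ V := by
      refine mem_valuationSubring_of_pow_mem V (n := 4) (by norm_num) ?_
      rw [show v ^ 4 = 1 - U ^ 4 by linear_combination h4]
      exact sub_mem V.one_mem (pow_mem hUV 4)
    rcases ((V.valuation_le_one_iff v).mpr hvV).lt_or_eq with hlt | heq
    · have hU1 : V.valuation U = 1 :=
        valuation_eq_one_of_pow_add_pow V (n := 4) (by norm_num) hlt
          (by rw [add_comm, h4, map_one])
      have hU0 : U ≠ 0 := by rintro rfl; simp at hU1
      have : y = -(D v * U⁻¹ ^ 3) := by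
        rw [hy]; field_simp; linear_combination hder
      rw [this]
      exact neg_mem (mul_mem (hpres V hV v hvV) (pow_mem (inv_mem_of_valuation_eq_one V hU1) 3))
    · have : y = D U * v⁻¹ ^ 3 := by rw [hy]; field_simp
      rw [this]
      exact mul_mem (hpres V hV U hUV) (pow_mem (inv_mem_of_valuation_eq_one V heq) 3)
  have hU0 : U ≠ 0 := by
    rintro rfl; exact hU isAlgebraic_zero
  have hinf : ∀ V : ValuationSubring F, (∀ c : k, algebraMap k F c ∈ V) → U ∉ V →
      V.valuation y < 1 := by
    intro V hV hUV
    have hslt : V.valuation U⁻¹ < 1 := by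
      rw [map_inv₀]
      apply inv_lt_one_of_one_lt₀
      rwa [← not_le, V.valuation_le_one_iff]
    have hr : V.valuation (v * U⁻¹) = 1 := by
      have h1 : (v * U⁻¹) ^ 4 = U⁻¹ ^ 4 - 1 := by
        field_simp; linear_combination h4
      have h2 : V.valuation (v * U⁻¹) ^ 4 = 1 := by
        rw [← map_pow, h1, Valuation.map_sub_eq_of_lt_right, map_one]
        rw [map_one, map_pow]
        exact pow_lt_one₀ zero_le hslt (by norm_num)
      exact le_antisymm ((pow_le_one_iff (by norm_num)).mp h2.le)
        ((one_le_pow_iff (by norm_num)).mp h2.ge)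
    have hDs : D U⁻¹ ∈ V := hpres V hV _ ((V.valuation_le_one_iff _).mp hslt.le)
    have : y = -(D U⁻¹ * (v * U⁻¹)⁻¹ ^ 3) * U⁻¹ := by
      rw [hy, D.leibniz_inv, smul_eq_mul]; field_simp
    rw [this, map_mul]
    exact mul_lt_one_of_nonneg_of_lt_one_right ((V.valuation_le_one_iff _).mpr
      (neg_mem (mul_mem hDs (pow_mem (inv_mem_of_valuation_eq_one V hr) 3)))) zero_le hslt
  have hyint : IsIntegral k y := isIntegral_of_forall_mem_valuationSubring fun V hV => by
    by_cases hUV : U ∈ V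
    · exact hfin V hV hUV
    · exact (V.valuation_le_one_iff _).mp (hinf V hV hUV).le
  obtain ⟨V, hV, hUV⟩ : ∃ V : ValuationSubring F, (∀ c : k, algebraMap k F c ∈ V) ∧ U ∉ V := by
    by_contra! hcon
    exact hU (isIntegral_of_forall_mem_valuationSubring hcon).isAlgebraic
  by_contra hDU
  have hy0 : y ≠ 0 := div_ne_zero hDU (pow_ne_zero _ hv0)
  have hyV : y⁻¹ ∈ V := mem_valuationSubring_of_isIntegral (B := k) V hV
    hyint.isAlgebraic.inv.isIntegral
  rw [← V.valuation_le_one_iff, map_inv₀] at hyV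
  have h1 := hinf V hV hUV
  have h2 : 0 < V.valuation y := by rw [zero_lt_iff, Valuation.ne_zero_iff]; exact hy0
  exact absurd hyV (not_le.mpr (one_lt_inv₀ h2 |>.mpr h1))

/-- The double cover `w² = U - λ` of the Fermat quartic has no point with values in a function
field generated by constants of a derivation `D` which does not kill `λ`. -/
theorem false_of_fermat_cover_of_dim_one [CharZero F] (D : Derivation ℤ F F)
    (hDk : ∀ c : k, D (algebraMap k F c) ∈ (algebraMap k F).range)
    {z : Set F} (hz : ∀ x ∈ z, D x = 0) (hgen : IntermediateField.adjoin k z = ⊤)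
    (hdim : ∀ t a : F, Transcendental k t → IsAlgebraic (Algebra.adjoin k {t}) a)
    {U v w : F} {l : k} (hU : Transcendental k U) (h4 : U ^ 4 + v ^ 4 = 1)
    (hw : w ^ 2 = U - algebraMap k F l) (hl : D (algebraMap k F l) ≠ 0) : False := by
  have hpres : ∀ V : ValuationSubring F, (∀ c : k, algebraMap k F c ∈ V) → ∀ a ∈ V, D a ∈ V :=
    fun V hV a ha => derivation_mem_valuationSubring D hDk hz hgen hdim ⟨U, hU⟩ V hV ha
  have hDU := derivation_eq_zero_of_fermat D hpres hU h4
  obtain ⟨V, hV, hVU⟩ : ∃ V : ValuationSubring F, (∀ c : k, algebraMap k F c ∈ V) ∧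
      (U - algebraMap k F l)⁻¹ ∉ V := by
    by_contra! hcon
    have h1 := (isIntegral_of_forall_mem_valuationSubring hcon).isAlgebraic.inv
    rw [inv_inv] at h1
    refine hU ?_
    simpa using h1.add (isAlgebraic_algebraMap l)
  have hwlt : V.valuation w < 1 := by
    rw [← V.valuation_le_one_iff, map_inv₀, ← hw, map_pow, not_le] at hVU
    by_contra! hcon
    exact absurd hVU (not_lt.mpr (inv_le_one_of_one_le₀ (one_le_pow₀ hcon)))
  have hDw : D (algebraMap k F l) = -(2 * D w) * w := by
    have h := congrArg D hw
    rw [map_sub, hDU, D.leibniz_pow] at h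
    simp only [smul_eq_mul, nsmul_eq_mul, Nat.cast_ofNat, Nat.add_one_sub_one, pow_one] at h
    linear_combination h
  obtain ⟨c, hc⟩ := hDk l
  have hc0 : c ≠ 0 := by rintro rfl; rw [map_zero] at hc; exact hl hc.symm
  have h1 := algebraMap_valuation_eq_one V hV hc0
  have hwV : w ∈ V := (V.valuation_le_one_iff _).mp hwlt.le
  rw [hc, hDw, map_mul] at h1
  refine h1.not_lt (mul_lt_one_of_nonneg_of_lt_one_right ((V.valuation_le_one_iff _).mpr
    (neg_mem (mul_mem ?_ (hpres V hV w hwV)))) zero_le hwlt)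
  exact_mod_cast natCast_mem V 2

end FermatCover

section FermatCoverGeneral

theorem isAlgebraic_adjoin_singleton_of_transcendental {k F : Type*} [Field k] [Field F]
    [Algebra k F] {U : F} (hU : Transcendental k U)
    (halg : Algebra.IsAlgebraic (Algebra.adjoin k {U}) F) {t : F} (ht : Transcendental k t) :
    Algebra.IsAlgebraic (Algebra.adjoin k {t}) F := by
  have hUi : AlgebraicIndependent k fun _ : Unit => U := by
    rwa [algebraicIndependent_unique_type_iff]
  have hti : AlgebraicIndependent k fun _ : Unit => t := by
    rwa [algebraicIndependent_unique_type_iff]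
  have hUb : IsTranscendenceBasis k fun _ : Unit => U := by
    rw [hUi.isTranscendenceBasis_iff_isAlgebraic, Set.range_const]
    exact halg
  have htb := AlgebraicIndependent.isTranscendenceBasis_of_lift_trdeg_le_of_finite hti
    (by rw [← hUb.lift_cardinalMk_eq_trdeg])
  have := htb.isAlgebraic
  rwa [Set.range_const] at this

theorem IntermediateField.isAlgebraic_adjoin_of_insert {C F : Type*} [Field C] [Field F]
    [Algebra C F] (k : IntermediateField C F) {s : Set F} (hs : s ⊆ k) {U a : F}
    (ha : IsAlgebraic (Algebra.adjoin C (insert U s)) a) :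
    IsAlgebraic (Algebra.adjoin k {U}) a := by
  have hle : Algebra.adjoin C (insert U s) ≤ (Algebra.adjoin k {U}).restrictScalars C := by
    refine Algebra.adjoin_le fun x hx => ?_
    rw [SetLike.mem_coe, Subalgebra.mem_restrictScalars]
    rcases Set.mem_insert_iff.mp hx with hx | hx
    · exact Algebra.subset_adjoin (Set.mem_singleton_iff.mpr hx)
    · exact (Algebra.adjoin k {U}).algebraMap_mem ⟨x, hs hx⟩
  exact ha.tower_top_of_subalgebra_le hle

theorem IntermediateField.derivation_mem_adjoin {C F : Type*} [Field C] [Field F]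
    [Algebra C F] (D : Derivation ℤ F F)
    (hDC : ∀ c : C, D (algebraMap C F c) ∈ (algebraMap C F).range) {s : Set F}
    (hs : ∀ x ∈ s, D x = 0) {x : F} (hx : x ∈ IntermediateField.adjoin C s) :
    D x ∈ IntermediateField.adjoin C s := by
  induction hx using IntermediateField.adjoin_induction with
  | mem x hx => rw [hs x hx]; exact zero_mem _
  | algebraMap c =>
    obtain ⟨c', hc'⟩ := hDC c
    rw [← hc']
    exact IntermediateField.algebraMap_mem _ c'
  | add x y _ _ hx hy => rw [map_add]; exact add_mem hx hy
  | inv x hxk hx =>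
    rw [D.leibniz_inv, smul_eq_mul]
    exact mul_mem (neg_mem (pow_mem (inv_mem hxk) 2)) hx
  | mul x y hx' hy' hx hy =>
    rw [Derivation.leibniz, smul_eq_mul, smul_eq_mul]
    exact add_mem (mul_mem hx' hy) (mul_mem hy' hx)

/-- The double cover `w² = U - λ` of the Fermat quartic has no point, with `U` transcendental over
`C`, with values in a field generated over `C` by constants of a derivation `D` which preserves
`C` and does not kill `λ`. -/
theorem false_of_fermat_cover {C F : Type*} [Field C] [Field F] [Algebra C F] [CharZero F]
    (D : Derivation ℤ F F) (hDC : ∀ c : C, D (algebraMap C F c) ∈ (algebraMap C F).range)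
    {z : Set F} (hz : ∀ x ∈ z, D x = 0) (hgen : IntermediateField.adjoin C z = ⊤)
    {U v w : F} {l : C} (hU : Transcendental C U) (h4 : U ^ 4 + v ^ 4 = 1)
    (hw : w ^ 2 = U - algebraMap C F l) (hl : D (algebraMap C F l) ≠ 0) : False := by
  have hspan : Algebra.IsAlgebraic (Algebra.adjoin C (insert U z)) F := by
    rw [← IntermediateField.isAlgebraic_adjoin_iff_top]
    have htop : IntermediateField.adjoin C (insert U z) = ⊤ := by
      rw [eq_top_iff, ← hgen]
      exact IntermediateField.adjoin.mono _ _ _ (Set.subset_insert U z)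
    refine ⟨fun a => ?_⟩
    exact isAlgebraic_algebraMap
      (⟨a, by rw [htop]; trivial⟩ : IntermediateField.adjoin C (insert U z))
  have hUind : AlgebraicIndepOn C id {U} := by
    have : AlgebraicIndependent C fun i : ({U} : Set F) => (i : F) := by
      rw [algebraicIndependent_unique_type_iff]; exact hU
    exact this
  obtain ⟨B, hUB, hBz, hB⟩ := exists_isTranscendenceBasis_between {U} (insert U z)
    (Set.singleton_subset_iff.mpr (Set.mem_insert U z)) hUind
  rw [Set.singleton_subset_iff] at hUB
  set s := B \ {U} with hs
  have hsz : s ⊆ z := fun x hx => (hBz hx.1).resolve_left hx.2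
  have hBs : insert U s = B := by rw [hs, Set.insert_sdiff_singleton, Set.insert_eq_of_mem hUB]
  set k := IntermediateField.adjoin C s with hk
  have hUk : Transcendental k U := by
    have h1 : AlgebraicIndepOn C id (insert U s) := by rw [hBs]; exact hB.1
    have h2 := ((AlgebraicIndepOn.insert_iff (by simp [hs])).mp h1).2
    rw [Set.image_id] at h2
    rwa [Transcendental, hk, IntermediateField.isAlgebraic_adjoin_iff]
  have hkU : Algebra.IsAlgebraic (Algebra.adjoin k {U}) F := by
    have hBalg := hB.isAlgebraic
    rw [Subtype.range_coe, ← hBs] at hBalg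
    exact ⟨fun a => IntermediateField.isAlgebraic_adjoin_of_insert k
      (IntermediateField.subset_adjoin C s) (hBalg.isAlgebraic a)⟩
  have hDk : ∀ c : k, D (algebraMap k F c) ∈ (algebraMap k F).range := fun c =>
    ⟨⟨_, IntermediateField.derivation_mem_adjoin D hDC (fun x hx => hz x (hsz hx)) c.2⟩, rfl⟩
  have hgenk : IntermediateField.adjoin k z = ⊤ := by
    have h1 : IntermediateField.adjoin C z ≤
        (IntermediateField.adjoin k z).restrictScalars C := by
      rw [IntermediateField.adjoin_le_iff]
      exact IntermediateField.subset_adjoin k z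
    rw [hgen] at h1
    exact eq_top_iff.mpr fun x _ => h1 trivial
  refine false_of_fermat_cover_of_dim_one (k := k) D hDk hz hgenk
    (fun t a ht => (isAlgebraic_adjoin_singleton_of_transcendental hUk hkU ht).isAlgebraic a)
    (w := w) (l := algebraMap C k l) hUk h4 ?_ ?_
  · exact hw
  · exact hl

end FermatCoverGeneral

section Derivations

open TensorProduct

theorem exists_derivation_of_formallyEtale {R S T : Type*} [CommRing R] [CommRing S] [CommRing T]
    [Algebra R S] [Algebra S T] [Algebra R T] [IsScalarTower R S T] [Algebra.FormallyEtale S T]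
    (δ : Derivation R S T) : ∃ d : Derivation R T T, ∀ s, d (algebraMap S T s) = δ s := by
  let e := KaehlerDifferential.tensorKaehlerEquivOfFormallyEtale R S T
  let L : T ⊗[S] (Ω[S⁄R]) →ₗ[T] T := δ.liftKaehlerDifferential.liftBaseChange T
  refine ⟨(L ∘ₗ e.symm.toLinearMap).compDer (KaehlerDifferential.D R T), fun s => ?_⟩
  change L (e.symm (KaehlerDifferential.D R T (algebraMap S T s))) = _
  rw [KaehlerDifferential.tensorKaehlerEquivOfFormallyEtale_symm_D_algebraMap]
  simp [L]

theorem exists_derivation_ne_zero_of_transcendental {k L : Type*} [Field k] [Field L]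
    [Algebra k L] [CharZero k] {t : L} (ht : Transcendental k t) :
    ∃ d : Derivation k L L, d t ≠ 0 := by
  have hind : AlgebraicIndepOn k id {t} := by
    have : AlgebraicIndependent k fun i : ({t} : Set L) => (i : L) := by
      rw [algebraicIndependent_unique_type_iff]; exact ht
    exact this
  obtain ⟨B, htB, hB⟩ := exists_isTranscendenceBasis_superset hind
  rw [Set.singleton_subset_iff] at htB
  let S := MvPolynomial B k
  let φ : S →ₐ[k] L := MvPolynomial.aeval ((↑) : B → L)
  have hφ : Function.Injective φ := algebraicIndependent_iff_injective_aeval.1 hB.1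
  let _ : Algebra S L := φ.toAlgebra
  have _ : IsScalarTower k S L := IsScalarTower.of_algebraMap_eq fun c => (φ.commutes c).symm
  have _ : FaithfulSMul S L := (faithfulSMul_iff_algebraMap_injective S L).mpr hφ
  have hS : Algebra.IsAlgebraic S L := by
    have := hB.isAlgebraic
    exact Algebra.IsAlgebraic.of_ringHom_of_comp_eq
      (S := Algebra.adjoin k (Set.range ((↑) : B → L)))
      hB.1.aevalEquiv.toRingEquiv.toRingHom (RingHom.id L) hB.1.aevalEquiv.surjective
      Function.injective_id (RingHom.ext fun p => hB.1.algebraMap_aevalEquiv p)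
  let _ : Algebra (FractionRing S) L := FractionRing.liftAlgebra S L
  have _ : IsScalarTower S (FractionRing S) L := FractionRing.isScalarTower_liftAlgebra S L
  have hQ : Algebra.IsAlgebraic (FractionRing S) L :=
    (IsFractionRing.comap_isAlgebraic_iff (A := S)).mp hS
  have h1 : Algebra.FormallyEtale S (FractionRing S) :=
    Algebra.FormallyEtale.of_isLocalization (nonZeroDivisors S)
  have h2 : Algebra.FormallyEtale (FractionRing S) L := Algebra.FormallyEtale.of_isSeparable _ _
  have h3 : Algebra.FormallyEtale S L := Algebra.FormallyEtale.comp S (FractionRing S) L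
  classical
  obtain ⟨d, hd⟩ := exists_derivation_of_formallyEtale (R := k) (S := S) (T := L)
    (MvPolynomial.mkDerivation k fun b => if b = ⟨t, htB⟩ then 1 else 0)
  refine ⟨d, ?_⟩
  have h := hd (MvPolynomial.X ⟨t, htB⟩)
  rw [MvPolynomial.mkDerivation_X, if_pos rfl] at h
  have ht' : algebraMap S L (MvPolynomial.X ⟨t, htB⟩) = t := MvPolynomial.aeval_X _ _
  rw [ht'] at h
  rw [h]
  exact one_ne_zero

theorem exists_derivation_complex {s : Set ℂ} (hs : s.Countable) :
    ∃ d : Derivation ℤ ℂ ℂ, (∀ c ∈ s, d c = 0) ∧ ∃ l, d l ≠ 0 := by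
  let k := Subfield.closure s
  obtain ⟨t, ht⟩ : ∃ t : ℂ, Transcendental k t := by
    by_contra! hcon
    have halg : Algebra.IsAlgebraic k ℂ := ⟨fun t => not_not.mp (hcon t)⟩
    have h1 := Algebra.IsAlgebraic.cardinalMk_le_max k ℂ
    have h2 : Cardinal.mk k ≤ Cardinal.aleph0 :=
      (Subfield.cardinalMk_closure_le_max s).trans (max_le hs.le_aleph0 le_rfl)
    rw [Cardinal.mk_complex] at h1
    exact absurd (h1.trans (max_le h2 le_rfl)) (not_le.mpr Cardinal.aleph0_lt_continuum)
  obtain ⟨d, hd⟩ := exists_derivation_ne_zero_of_transcendental ht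
  refine ⟨d.restrictScalars ℤ, fun c hc => ?_, t, hd⟩
  exact d.map_algebraMap (⟨c, Subfield.subset_closure hc⟩ : k)

theorem exists_derivation_fractionField {σ C K : Type*} [CommRing C] [Field K] [Algebra C K]
    [Algebra (MvPolynomial σ C) K] [IsScalarTower C (MvPolynomial σ C) K]
    [IsFractionRing (MvPolynomial σ C) K] (d : Derivation ℤ C C) (e : σ → K) :
    ∃ D : Derivation ℤ K K, (∀ c, D (algebraMap C K c) = algebraMap C K (d c)) ∧
      ∀ i, D (algebraMap (MvPolynomial σ C) K (MvPolynomial.X i)) = e i := by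
  let A := MvPolynomial σ C
  let κ : C →+* TrivSqZeroExt K K :=
    { toFun := fun c => TrivSqZeroExt.inl (algebraMap C K c) +
        TrivSqZeroExt.inr (algebraMap C K (d c))
      map_one' := by ext <;> simp
      map_zero' := by ext <;> simp
      map_add' := fun x y => by
        ext <;> simp only [TrivSqZeroExt.fst_add, TrivSqZeroExt.snd_add, TrivSqZeroExt.fst_inl,
          TrivSqZeroExt.snd_inl, TrivSqZeroExt.fst_inr, TrivSqZeroExt.snd_inr, map_add] <;> ring
      map_mul' := fun x y => by
        ext
        · simp
        · simp only [TrivSqZeroExt.snd_mul, TrivSqZeroExt.fst_add, TrivSqZeroExt.snd_add,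
            TrivSqZeroExt.fst_inl, TrivSqZeroExt.snd_inl, TrivSqZeroExt.fst_inr,
            TrivSqZeroExt.snd_inr, Derivation.leibniz, map_add, smul_eq_mul, map_mul,
            MulOpposite.smul_eq_mul_unop, MulOpposite.unop_op]
          ring }
  let φ : A →+* TrivSqZeroExt K K :=
    MvPolynomial.eval₂Hom κ fun i =>
      TrivSqZeroExt.inl (algebraMap A K (MvPolynomial.X i)) + TrivSqZeroExt.inr (e i)
  have hC : ∀ c, algebraMap A K (MvPolynomial.C c) = algebraMap C K c := fun c =>
    (IsScalarTower.algebraMap_apply C A K c).symm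
  have hfst : ∀ p, (φ p).fst = algebraMap A K p := by
    intro p
    have : ((TrivSqZeroExt.fstHom K K K : TrivSqZeroExt K K →+* K).comp φ) = algebraMap A K := by
      ext i
      · simp [φ, κ, hC]
      · simp [φ]
    exact congrArg (fun f => f p) this
  let δ : Derivation ℤ A K := Derivation.mk'
    { toFun := fun p => (φ p).snd
      map_add' := fun p q => by simp
      map_smul' := fun m p => by simp }
    (fun p q => by
      change (φ (p * q)).snd = p • (φ q).snd + q • (φ p).snd
      rw [map_mul, TrivSqZeroExt.snd_mul, hfst, hfst, Algebra.smul_def p,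
        Algebra.smul_def q, smul_eq_mul, MulOpposite.smul_eq_mul_unop, MulOpposite.unop_op,
        mul_comm (algebraMap A K q)])
  have _ : Algebra.FormallyEtale A K := Algebra.FormallyEtale.of_isLocalization (nonZeroDivisors A)
  obtain ⟨D, hD⟩ := exists_derivation_of_formallyEtale δ
  refine ⟨D, fun c => ?_, fun i => ?_⟩
  · rw [← hC, hD (MvPolynomial.C c)]
    change (φ (MvPolynomial.C c)).snd = _
    rw [MvPolynomial.coe_eval₂Hom, MvPolynomial.eval₂_C]
    exact zero_add _
  · rw [hD (MvPolynomial.X i)]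
    change (φ (MvPolynomial.X i)).snd = _
    rw [MvPolynomial.coe_eval₂Hom, MvPolynomial.eval₂_X]
    exact zero_add _

end Derivations

section PolynomialValuations

open MvPolynomial

theorem exists_derivation_of_surjective {V F : Type*} [CommRing V] [CommRing F] (r : V →+* F)
    (hr : Function.Surjective r) (δ : Derivation ℤ V V) (h : ∀ x, r x = 0 → r (δ x) = 0) :
    ∃ d : Derivation ℤ F F, ∀ x, d (r x) = r (δ x) := by
  have key : ∀ {x y}, r x = r y → r (δ x) = r (δ y) := fun {x y} hxy => by
    rw [← sub_eq_zero, ← map_sub, ← map_sub]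
    exact h _ (by rw [map_sub, hxy, sub_self])
  have hs := Function.surjInv_eq hr
  let L : F →+ F := AddMonoidHom.mk' (fun y => r (δ (Function.surjInv hr y))) fun a b => by
    rw [← map_add, ← map_add]
    exact key (by rw [map_add, hs, hs, hs])
  have hL : ∀ x, L (r x) = r (δ x) := fun x => key (hs _)
  refine ⟨Derivation.mk' L.toIntLinearMap fun a b => ?_, hL⟩
  obtain ⟨x, rfl⟩ := hr a
  obtain ⟨y, rfl⟩ := hr b
  change L (r x * r y) = r x • L (r y) + r y • L (r x)
  rw [← map_mul, hL, hL, hL, Derivation.leibniz]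
  simp

variable {σ K : Type*} [Field K] [Algebra (MvPolynomial σ ℂ) K]

variable (σ) in
/-- The valuation ring `V` contains the polynomial ring `ℂ[x]` and is a localization of it. -/
structure IsPolynomialLocalization (V : ValuationSubring K) : Prop where
  algebraMap_mem : ∀ p : MvPolynomial σ ℂ, algebraMap (MvPolynomial σ ℂ) K p ∈ V
  exists_eq_div : ∀ z ∈ V, ∃ a b : MvPolynomial σ ℂ,
    V.valuation (algebraMap (MvPolynomial σ ℂ) K b) = 1 ∧
      z = algebraMap (MvPolynomial σ ℂ) K a / algebraMap (MvPolynomial σ ℂ) K b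

theorem IsPolynomialLocalization.dvd_of_valuation_lt_one [FaithfulSMul (MvPolynomial σ ℂ) K]
    {V : ValuationSubring K} (hV : IsPolynomialLocalization σ V)
    {q p : MvPolynomial σ ℂ} (hq : Prime q)
    (hqV : V.valuation (algebraMap (MvPolynomial σ ℂ) K q) < 1)
    (hpV : V.valuation (algebraMap (MvPolynomial σ ℂ) K p) < 1) : q ∣ p := by
  have hinj := FaithfulSMul.algebraMap_injective (MvPolynomial σ ℂ) K
  by_contra hqp
  have hp0 : p ≠ 0 := fun h => hqp (h ▸ dvd_zero q)
  have hp0' := (map_ne_zero_iff _ hinj).mpr hp0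
  have hq0' := (map_ne_zero_iff _ hinj).mpr hq.ne_zero
  have hb0 : ∀ b, V.valuation (algebraMap (MvPolynomial σ ℂ) K b) = 1 →
      algebraMap (MvPolynomial σ ℂ) K b ≠ 0 := fun b hb h => by simp [h] at hb
  have hdvd : ∀ s b, V.valuation (algebraMap (MvPolynomial σ ℂ) K b) = 1 →
      V.valuation (algebraMap (MvPolynomial σ ℂ) K s) < 1 → ¬ s ∣ b := by
    rintro s b hb hs ⟨c, rfl⟩
    have h1 := (V.valuation_le_one_iff _).mpr (hV.algebraMap_mem c)
    rw [map_mul, map_mul] at hb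
    exact (mul_lt_one_of_lt_of_le hs h1).ne hb
  rcases V.mem_or_inv_mem (algebraMap _ K p / algebraMap _ K q) with h | h
  · obtain ⟨a, b, hb, hab⟩ := hV.exists_eq_div _ h
    rw [div_eq_div_iff hq0' (hb0 b hb), ← map_mul, ← map_mul] at hab
    have h2 : q ∣ p * b := ⟨a, by rw [hinj hab, mul_comm]⟩
    exact hdvd q b hb hqV ((hq.dvd_or_dvd h2).resolve_left hqp)
  · rw [inv_div] at h
    obtain ⟨a, b, hb, hab⟩ := hV.exists_eq_div _ h
    rw [div_eq_div_iff hp0' (hb0 b hb), ← map_mul, ← map_mul] at hab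
    have hab := hinj hab
    obtain ⟨a', rfl⟩ := (hq.dvd_or_dvd (Dvd.intro b hab)).resolve_right hqp
    have h3 : b = a' * p := mul_left_cancel₀ hq.ne_zero (by rw [hab]; ring)
    exact hdvd p b hb hpV ⟨a', by rw [h3, mul_comm]⟩

variable [Algebra ℂ K]

/-- The double cover `w² = U - l` of the Fermat quartic `U⁴ + v⁴ = 1` has a nonconstant point in
the residue field of `V`. -/
def HasCoverPoint (l : ℂ) (V : ValuationSubring K) : Prop :=
  ∃ U ∈ V, ∃ v ∈ V, ∃ w ∈ V, V.valuation (U ^ 4 + v ^ 4 - 1) < 1 ∧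
    V.valuation (w ^ 2 - (U - algebraMap ℂ K l)) < 1 ∧
    ∀ c : ℂ, ¬ V.valuation (U - algebraMap ℂ K c) < 1

theorem transcendental_of_ne_algebraMap {C F : Type*} [Field C] [IsAlgClosed C] [Field F]
    [Algebra C F] {U : F} (hU : ∀ c, U ≠ algebraMap C F c) : Transcendental C U := by
  intro h
  obtain ⟨c, hc⟩ := minpoly.mem_range_of_degree_eq_one C U
    (IsAlgClosed.degree_eq_one_of_irreducible C (minpoly.irreducible h.isIntegral))
  exact hU c hc.symm

/-- A localization of `ℂ[x]` at a prime element preserved by a derivation has no nonconstant point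
on the cover, if its residue field is generated by constants of the derivation. -/
theorem IsPolynomialLocalization.not_hasCoverPoint [IsScalarTower ℂ (MvPolynomial σ ℂ) K]
    [FaithfulSMul (MvPolynomial σ ℂ) K] {V : ValuationSubring K}
    (hV : IsPolynomialLocalization σ V) {q : MvPolynomial σ ℂ} (hq : Prime q)
    (hqV : V.valuation (algebraMap (MvPolynomial σ ℂ) K q) < 1) (D : Derivation ℤ K K)
    {d : ℂ → ℂ} (hDC : ∀ c, D (algebraMap ℂ K c) = algebraMap ℂ K (d c)) {l : ℂ} (hl : d l ≠ 0)
    (hDX : ∀ i, D (algebraMap (MvPolynomial σ ℂ) K (X i)) ∈ V)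
    (hDq : V.valuation (D (algebraMap (MvPolynomial σ ℂ) K q)) < 1)
    {z : Set K} (hzV : ∀ x ∈ z, x ∈ V) (hz : ∀ x ∈ z, V.valuation (D x) < 1)
    (hgen : ∀ i, ∃ y ∈ Algebra.adjoin ℂ z,
      V.valuation (algebraMap (MvPolynomial σ ℂ) K (X i) - y) < 1) :
    ¬ HasCoverPoint l V := by
  rintro ⟨U, hUV, v, hvV, w, hwV, h4, h2, hU⟩
  set ι := algebraMap (MvPolynomial σ ℂ) K with hι
  have hιC : ∀ c, ι (C c) = algebraMap ℂ K c := fun c =>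
    (IsScalarTower.algebraMap_apply ℂ (MvPolynomial σ ℂ) K c).symm
  have hCV : ∀ c, algebraMap ℂ K c ∈ V := fun c => hιC c ▸ hV.algebraMap_mem _
  have hDp : ∀ p, D (ι p) ∈ V := by
    intro p
    induction p using MvPolynomial.induction_on with
    | C c => rw [hιC, hDC]; exact hCV _
    | add p q hp hq => rw [map_add, map_add]; exact add_mem hp hq
    | mul_X p i hp =>
      rw [map_mul, Derivation.leibniz]
      exact add_mem (mul_mem (hV.algebraMap_mem _) (hDX i)) (mul_mem (hV.algebraMap_mem _) hp)
  have hDfrac : ∀ a b, V.valuation (ι b) = 1 →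
      D (ι a / ι b) = (ι b)⁻¹ * (D (ι a) - ι a / ι b * D (ι b)) := by
    intro a b hb
    have hb0 : ι b ≠ 0 := fun h => by simp [h] at hb
    rw [D.leibniz_div, smul_eq_mul, smul_eq_mul, smul_eq_mul]
    field_simp
  have hDV : ∀ x ∈ V, D x ∈ V := by
    intro x hx
    obtain ⟨a, b, hb, rfl⟩ := hV.exists_eq_div x hx
    rw [hDfrac a b hb]
    exact mul_mem (inv_mem_of_valuation_eq_one V hb) (sub_mem (hDp _) (mul_mem hx (hDp _)))
  have hDm : ∀ x, V.valuation x < 1 → V.valuation (D x) < 1 := by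
    intro x hx
    obtain ⟨a, b, hb, rfl⟩ := hV.exists_eq_div x ((V.valuation_le_one_iff _).mp hx.le)
    rw [hDfrac a b hb, map_mul, map_inv₀, hb, inv_one, one_mul]
    refine Valuation.map_sub_lt _ ?_ ?_
    · rw [map_div₀, hb, div_one] at hx
      obtain ⟨a', rfl⟩ := hV.dvd_of_valuation_lt_one hq hqV hx
      rw [map_mul, Derivation.leibniz, smul_eq_mul, smul_eq_mul]
      refine Valuation.map_add_lt _ ?_ ?_
      · rw [map_mul]
        exact mul_lt_one_of_lt_of_le hqV ((V.valuation_le_one_iff _).mpr (hDp a'))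
      · rw [map_mul, mul_comm]
        exact mul_lt_one_of_lt_of_le hDq
          ((V.valuation_le_one_iff _).mpr (hV.algebraMap_mem a'))
    · rw [map_mul]
      exact mul_lt_one_of_lt_of_le hx ((V.valuation_le_one_iff _).mpr (hDp b))
  let r : V →+* IsLocalRing.ResidueField V := IsLocalRing.residue V
  have hr0 : ∀ x : V, r x = 0 ↔ V.valuation (x : K) < 1 := fun x => by
    rw [IsLocalRing.residue_eq_zero_iff, ValuationSubring.valuation_lt_one_iff]
  let cV : ℂ →+* V := (algebraMap ℂ K).codRestrict V.toSubring hCV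
  let _ : Algebra ℂ (IsLocalRing.ResidueField V) := (r.comp cV).toAlgebra
  have hrC : ∀ c, algebraMap ℂ (IsLocalRing.ResidueField V) c = r (cV c) := fun c => rfl
  have _ : CharZero (IsLocalRing.ResidueField V) := charZero_of_injective_algebraMap
    (algebraMap ℂ (IsLocalRing.ResidueField V)).injective
  let δ : Derivation ℤ V V := Derivation.mk'
    { toFun := fun x => ⟨D x, hDV x x.2⟩
      map_add' := fun x y => Subtype.ext (by simp)
      map_smul' := fun m x => Subtype.ext (by simp) }
    fun x y => Subtype.ext (by simp)
  obtain ⟨E, hE⟩ := exists_derivation_of_surjective r IsLocalRing.residue_surjective δ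
    fun x hx => (hr0 _).mpr (hDm _ ((hr0 x).mp hx))
  have hδC : ∀ c, δ (cV c) = cV (d c) := fun c => Subtype.ext (hDC c)
  have hadj : ∀ y ∈ Algebra.adjoin ℂ z, ∃ h : y ∈ V,
      r ⟨y, h⟩ ∈ IntermediateField.adjoin ℂ (r '' {x : V | (x : K) ∈ z}) := by
    intro y hy
    induction hy using Algebra.adjoin_induction with
    | mem x hx => exact ⟨hzV x hx, IntermediateField.subset_adjoin _ _ ⟨⟨x, hzV x hx⟩, hx, rfl⟩⟩
    | algebraMap c => exact ⟨hCV c, IntermediateField.algebraMap_mem _ c⟩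
    | add x y _ _ hx hy =>
      obtain ⟨hx, hx'⟩ := hx
      obtain ⟨hy, hy'⟩ := hy
      exact ⟨add_mem hx hy, by
        have h := add_mem hx' hy'
        rw [← map_add] at h
        exact h⟩
    | mul x y _ _ hx hy =>
      obtain ⟨hx, hx'⟩ := hx
      obtain ⟨hy, hy'⟩ := hy
      exact ⟨mul_mem hx hy, by
        have h := mul_mem hx' hy'
        rw [← map_mul] at h
        exact h⟩
  have hpoly : ∀ p, r ⟨ι p, hV.algebraMap_mem p⟩ ∈
      IntermediateField.adjoin ℂ (r '' {x : V | (x : K) ∈ z}) := by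
    intro p
    induction p using MvPolynomial.induction_on with
    | C c =>
      have : (⟨ι (C c), hV.algebraMap_mem _⟩ : V) = cV c := Subtype.ext (hιC c)
      rw [this, ← hrC]
      exact IntermediateField.algebraMap_mem _ c
    | add p q hp hq =>
      have : (⟨ι (p + q), hV.algebraMap_mem _⟩ : V) =
        ⟨ι p, hV.algebraMap_mem _⟩ + ⟨ι q, hV.algebraMap_mem _⟩ := Subtype.ext (map_add _ _ _)
      rw [this, map_add]
      exact add_mem hp hq
    | mul_X p i hp =>
      have : (⟨ι (p * X i), hV.algebraMap_mem _⟩ : V) =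
        ⟨ι p, hV.algebraMap_mem _⟩ * ⟨ι (X i), hV.algebraMap_mem _⟩ := Subtype.ext (map_mul _ _ _)
      rw [this, map_mul]
      refine mul_mem hp ?_
      obtain ⟨y, hy, hyi⟩ := hgen i
      obtain ⟨hyV, hy⟩ := hadj y hy
      have h : r ⟨ι (X i), hV.algebraMap_mem _⟩ = r ⟨y, hyV⟩ := by
        rw [← sub_eq_zero, ← map_sub, hr0]
        exact hyi
      rwa [h]
  refine false_of_fermat_cover (C := ℂ) E (z := r '' {x : V | (x : K) ∈ z})
    (U := r ⟨U, hUV⟩) (v := r ⟨v, hvV⟩) (w := r ⟨w, hwV⟩) (l := l) ?_ ?_ ?_ ?_ ?_ ?_ ?_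
  · exact fun c => ⟨d c, by rw [hrC, hrC, hE, hδC]⟩
  · rintro _ ⟨x, hx, rfl⟩
    rw [hE, hr0]
    exact hz _ hx
  · refine eq_top_iff.mpr fun y _ => ?_
    obtain ⟨x, rfl⟩ := IsLocalRing.residue_surjective y
    obtain ⟨a, b, (hb : V.valuation (ι b) = 1), hab⟩ := hV.exists_eq_div x x.2
    have hb0 : ι b ≠ 0 := fun h => by simp [h] at hb
    have hrb : r ⟨ι b, hV.algebraMap_mem b⟩ ≠ 0 := by
      rw [ne_eq, hr0]
      exact hb.not_lt
    have h1 : x * ⟨ι b, hV.algebraMap_mem b⟩ = ⟨ι a, hV.algebraMap_mem a⟩ :=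
      Subtype.ext (by change (x : K) * ι b = ι a; rw [hab, div_mul_cancel₀ _ hb0])
    have h2 : r x = r ⟨ι a, hV.algebraMap_mem a⟩ / r ⟨ι b, hV.algebraMap_mem b⟩ := by
      rw [eq_div_iff hrb, ← map_mul, h1]
    change r x ∈ _
    rw [h2]
    exact div_mem (hpoly a) (hpoly b)
  · refine transcendental_of_ne_algebraMap fun c hc => hU c ?_
    rw [hrC, ← sub_eq_zero, ← map_sub, hr0] at hc
    exact hc
  · rw [← sub_eq_zero, ← map_pow, ← map_pow, ← map_add, ← map_one r, ← map_sub, hr0]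
    exact h4
  · rw [← sub_eq_zero, hrC, ← map_pow, ← map_sub, ← map_sub, hr0]
    exact h2
  · rw [hrC, hE, hδC, ← hrC]
    exact (map_ne_zero _).mpr hl

end PolynomialValuations

section Transport

open MvPolynomial

theorem valuation_lt_one_iff_inv_notMem {K : Type*} [Field K] (V : ValuationSubring K) {x : K} :
    V.valuation x < 1 ↔ x = 0 ∨ x⁻¹ ∉ V := by
  rcases eq_or_ne x 0 with rfl | hx
  · simp
  · rw [← V.valuation_le_one_iff, map_inv₀, not_le, or_iff_right hx,
      one_lt_inv₀ (zero_lt_iff.mpr ((map_ne_zero _).mpr hx))]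

theorem valuation_eq_one_iff_mem {K : Type*} [Field K] (V : ValuationSubring K) {x : K} :
    V.valuation x = 1 ↔ x ∈ V ∧ ¬ V.valuation x < 1 := by
  rw [← V.valuation_le_one_iff, not_lt, le_antisymm_iff]

theorem valuation_comap_lt_one_iff {K : Type*} [Field K] (V : ValuationSubring K) (g : K →+* K)
    {x : K} : (V.comap g).valuation x < 1 ↔ V.valuation (g x) < 1 := by
  rw [valuation_lt_one_iff_inv_notMem, valuation_lt_one_iff_inv_notMem, ValuationSubring.mem_comap,
    map_inv₀, map_eq_zero]

theorem valuation_comap_eq_one_iff {K : Type*} [Field K] (V : ValuationSubring K) (g : K →+* K)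
    {x : K} : (V.comap g).valuation x = 1 ↔ V.valuation (g x) = 1 := by
  rw [valuation_eq_one_iff_mem, valuation_eq_one_iff_mem, ValuationSubring.mem_comap,
    valuation_comap_lt_one_iff]

theorem dvd_derivation_of_dvd {A : Type*} [CommRing A] [IsDomain A] [UniqueFactorizationMonoid A]
    [Algebra ℚ A] {D : A → A} (hD : ∀ a b, D (a * b) = a * D b + b * D a) {q p : A} (hq : Prime q)
    (hp : p ≠ 0) (hqp : q ∣ p) (hDp : D p = 0) : q ∣ D q := by
  have hpow : ∀ m : ℕ, D (q ^ (m + 1)) = (m + 1 : ℕ) * (q ^ m * D q) := by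
    intro m
    induction m with
    | zero => simp
    | succ m ih => rw [pow_succ, hD, ih]; push_cast; ring
  obtain ⟨e, r, hr, rfl⟩ := WfDvdMonoid.max_power_factor hp hq.irreducible
  cases e with
  | zero => rw [pow_zero, one_mul] at hqp; exact absurd hqp hr
  | succ m =>
    rw [hD, hpow] at hDp
    have h : q ^ m * (q * D r + r * ((m + 1 : ℕ) * D q)) = 0 := by rw [← hDp]; ring
    have h' := (mul_eq_zero.mp h).resolve_left (pow_ne_zero _ hq.ne_zero)
    have h2 : q ∣ r * ((m + 1 : ℕ) * D q) := ⟨-D r, by linear_combination h'⟩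
    have h3 := (hq.dvd_or_dvd h2).resolve_left hr
    have hu : IsUnit ((m + 1 : ℕ) : A) := by
      rw [← map_natCast (algebraMap ℚ A)]
      exact (IsUnit.mk0 _ (by exact_mod_cast m.succ_ne_zero)).map _
    exact hu.dvd_mul_left.mp h3

variable {σ K : Type*} [Field K] [Algebra ℂ K] [Algebra (MvPolynomial σ ℂ) K]

theorem HasCoverPoint.comap {l : ℂ} {V : ValuationSubring K} (h : HasCoverPoint l V)
    (g : K ≃ₐ[ℂ] K) : HasCoverPoint l (V.comap (g : K →+* K)) := by
  obtain ⟨U, hUV, v, hvV, w, hwV, h4, h2, hU⟩ := h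
  refine ⟨g.symm U, ?_, g.symm v, ?_, g.symm w, ?_, ?_, ?_, fun c => ?_⟩
  · simpa using hUV
  · simpa using hvV
  · simpa using hwV
  · rw [valuation_comap_lt_one_iff]; simpa using h4
  · rw [valuation_comap_lt_one_iff]; simpa using h2
  · rw [valuation_comap_lt_one_iff]; simpa using hU c

variable [IsScalarTower ℂ (MvPolynomial σ ℂ) K]

theorem IsPolynomialLocalization.comap_symm {V : ValuationSubring K}
    (hV : IsPolynomialLocalization σ V) (f : K ≃ₐ[ℂ] K)
    (hmem : ∀ i, f.symm (algebraMap (MvPolynomial σ ℂ) K (X i)) ∈ V)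
    (hfrac : ∀ i, ∃ a s : MvPolynomial σ ℂ,
      V.valuation (f.symm (algebraMap (MvPolynomial σ ℂ) K s)) = 1 ∧
      f (algebraMap (MvPolynomial σ ℂ) K (X i)) =
        algebraMap (MvPolynomial σ ℂ) K a / algebraMap (MvPolynomial σ ℂ) K s) :
    IsPolynomialLocalization σ (V.comap (f.symm : K →+* K)) := by
  set ι := algebraMap (MvPolynomial σ ℂ) K with hι
  have hιC : ∀ c, ι (C c) = algebraMap ℂ K c := fun c =>
    (IsScalarTower.algebraMap_apply ℂ (MvPolynomial σ ℂ) K c).symm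
  have hne : ∀ s, V.valuation (f.symm (ι s)) = 1 → ι s ≠ 0 := fun s hs h => by
    rw [h, map_zero, map_zero] at hs; exact zero_ne_one hs
  have hpoly : ∀ p, f.symm (ι p) ∈ V ∧ ∃ a s : MvPolynomial σ ℂ,
      V.valuation (f.symm (ι s)) = 1 ∧ f (ι p) = ι a / ι s := by
    intro p
    induction p using MvPolynomial.induction_on with
    | C c =>
      rw [hιC, AlgEquiv.commutes, AlgEquiv.commutes, ← hιC]
      exact ⟨hV.algebraMap_mem _, C c, 1, by simp, by simp⟩
    | add p q hp hq =>
      obtain ⟨hp, a, s, hs, hp'⟩ := hp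
      obtain ⟨hq, b, t, ht, hq'⟩ := hq
      refine ⟨by rw [map_add, map_add]; exact add_mem hp hq, a * t + s * b, s * t, ?_, ?_⟩
      · simp [hs, ht]
      · rw [map_add, map_add, hp', hq', div_add_div _ _ (hne s hs) (hne t ht)]
        simp
    | mul_X p i hp =>
      obtain ⟨hp, a, s, hs, hp'⟩ := hp
      obtain ⟨b, t, ht, hq'⟩ := hfrac i
      refine ⟨by rw [map_mul, map_mul]; exact mul_mem hp (hmem i), a * b, s * t, ?_, ?_⟩
      · simp [hs, ht]
      · rw [map_mul, map_mul, hp', hq', div_mul_div_comm]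
        simp
  refine ⟨fun p => (hpoly p).1, fun z hz => ?_⟩
  obtain ⟨a, b, hb, hab⟩ := hV.exists_eq_div _ hz
  obtain ⟨-, a', s, hs, ha⟩ := hpoly a
  obtain ⟨-, b', t, ht, hb'⟩ := hpoly b
  have hz' : z = f (ι a) / f (ι b) := by
    rw [← map_div₀, ← hab]; exact (f.apply_symm_apply z).symm
  have hbt : ι b' = f (ι b) * ι t := by rw [hb', div_mul_cancel₀ _ (hne t ht)]
  refine ⟨a' * t, s * b', ?_, ?_⟩
  · rw [valuation_comap_eq_one_iff]
    change V.valuation (f.symm (ι (s * b'))) = 1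
    rw [map_mul, map_mul, map_mul, hs, hbt, map_mul, map_mul, ht, f.symm_apply_apply, hb]
    simp
  · rw [hz', ha, hb', map_mul, map_mul, div_div_div_eq]

/-- A localization of `ℂ[x]` whose maximal ideal contains a nonzero constant of a derivation
preserving `ℂ[x]` has no nonconstant point on the cover, if its residue field is generated by
constants of the derivation. -/
theorem IsPolynomialLocalization.not_hasCoverPoint_of_constant [FaithfulSMul (MvPolynomial σ ℂ) K]
    {V : ValuationSubring K} (hV : IsPolynomialLocalization σ V) {p : MvPolynomial σ ℂ} (hp : p ≠ 0)
    (hpV : V.valuation (algebraMap (MvPolynomial σ ℂ) K p) < 1) (D : Derivation ℤ K K)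
    {d : ℂ → ℂ} (hDC : ∀ c, D (algebraMap ℂ K c) = algebraMap ℂ K (d c)) {l : ℂ} (hl : d l ≠ 0)
    (hDX : ∀ i, D (algebraMap (MvPolynomial σ ℂ) K (X i)) ∈ (algebraMap (MvPolynomial σ ℂ) K).range)
    (hDp : D (algebraMap (MvPolynomial σ ℂ) K p) = 0)
    {z : Set K} (hzV : ∀ x ∈ z, x ∈ V) (hz : ∀ x ∈ z, V.valuation (D x) < 1)
    (hgen : ∀ i, ∃ y ∈ Algebra.adjoin ℂ z,
      V.valuation (algebraMap (MvPolynomial σ ℂ) K (X i) - y) < 1) :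
    ¬ HasCoverPoint l V := by
  set ι := algebraMap (MvPolynomial σ ℂ) K with hι
  have hinj : Function.Injective ι := FaithfulSMul.algebraMap_injective (MvPolynomial σ ℂ) K
  have hιC : ∀ c, ι (C c) = algebraMap ℂ K c := fun c =>
    (IsScalarTower.algebraMap_apply ℂ (MvPolynomial σ ℂ) K c).symm
  have hDA : ∀ p, ∃ p', ι p' = D (ι p) := by
    intro p
    induction p using MvPolynomial.induction_on with
    | C c => exact ⟨C (d c), by rw [hιC, hιC, hDC]⟩
    | add p q hp hq =>
      obtain ⟨p', hp⟩ := hp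
      obtain ⟨q', hq⟩ := hq
      exact ⟨p' + q', by rw [map_add, map_add, map_add, hp, hq]⟩
    | mul_X p i hp =>
      obtain ⟨p', hp⟩ := hp
      obtain ⟨q', hq⟩ := hDX i
      exact ⟨p * q' + X i * p', by
        rw [map_add, map_mul, map_mul, map_mul, Derivation.leibniz, hp, hq, smul_eq_mul,
          smul_eq_mul]⟩
  choose E hE using hDA
  have hfac : ∃ q ∈ UniqueFactorizationMonoid.factors p, V.valuation (ι q) < 1 := by
    by_contra! hcon
    obtain ⟨u, hu⟩ := UniqueFactorizationMonoid.factors_prod hp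
    have h1 : ∀ s : MvPolynomial σ ℂ, V.valuation (ι s) ≤ 1 := fun s =>
      (V.valuation_le_one_iff _).mpr (hV.algebraMap_mem s)
    have hunit : V.valuation (ι u) = 1 := by
      refine le_antisymm (h1 _) ?_
      have h2 : V.valuation (ι u) * V.valuation (ι (u⁻¹ : (MvPolynomial σ ℂ)ˣ)) = 1 := by
        rw [← map_mul, ← map_mul, Units.mul_inv, map_one, map_one]
      rw [← h2]
      exact mul_le_of_le_one_right' (h1 _)
    rw [← hu, map_mul, map_mul, hunit, mul_one, map_multiset_prod, map_multiset_prod] at hpV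
    refine hpV.ne (Multiset.prod_eq_one fun x hx => ?_)
    simp only [Multiset.map_map, Multiset.mem_map] at hx
    obtain ⟨q, hq, rfl⟩ := hx
    exact le_antisymm (h1 q) (hcon q hq)
  obtain ⟨q, hqf, hqV⟩ := hfac
  have hq := UniqueFactorizationMonoid.prime_of_factor q hqf
  have hqp := UniqueFactorizationMonoid.dvd_of_mem_factors hqf
  have hE' : ∀ a b, E (a * b) = a * E b + b * E a := fun a b => hinj (by
    rw [hE, map_mul, Derivation.leibniz, map_add, map_mul, map_mul, hE, hE, smul_eq_mul,
      smul_eq_mul])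
  obtain ⟨c, hc⟩ := dvd_derivation_of_dvd hE' hq hp hqp (hinj (by rw [hE, hDp, map_zero]))
  refine hV.not_hasCoverPoint hq hqV D hDC hl (fun i => ?_) ?_ hzV hz hgen
  · rw [← hι, ← hE]
    exact hV.algebraMap_mem _
  · rw [← hι, ← hE, hc, map_mul, map_mul]
    exact mul_lt_one_of_lt_of_le hqV ((V.valuation_le_one_iff _).mpr (hV.algebraMap_mem c))

theorem IsPolynomialLocalization.comap_symm_of_mem_closure [FaithfulSMul (MvPolynomial σ ℂ) K]
    {V : ValuationSubring K} (hV : IsPolynomialLocalization σ V) (D : Derivation ℤ K K)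
    {d : ℂ → ℂ} (hDC : ∀ c, D (algebraMap ℂ K c) = algebraMap ℂ K (d c)) {l : ℂ} (hl : d l ≠ 0)
    (hDX : ∀ i, D (algebraMap (MvPolynomial σ ℂ) K (X i)) = 0) (h : HasCoverPoint l V)
    (f : K ≃ₐ[ℂ] K) {s : Set K}
    (hs : s = Set.range (fun i => algebraMap (MvPolynomial σ ℂ) K (X i)) ∪
      algebraMap ℂ K '' {c | d c = 0})
    (hf : ∀ i, f (algebraMap (MvPolynomial σ ℂ) K (X i)) ∈ Subfield.closure s)
    (hf' : ∀ i, f.symm (algebraMap (MvPolynomial σ ℂ) K (X i)) ∈ Subfield.closure s) :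
    IsPolynomialLocalization σ (V.comap (f.symm : K →+* K)) := by
  set ι := algebraMap (MvPolynomial σ ℂ) K with hι
  have hinj : Function.Injective ι := FaithfulSMul.algebraMap_injective (MvPolynomial σ ℂ) K
  have hιC : ∀ c, ι (C c) = algebraMap ℂ K c := fun c =>
    (IsScalarTower.algebraMap_apply ℂ (MvPolynomial σ ℂ) K c).symm
  have hR : ∀ y ∈ Subring.closure s, ∃ p, y = ι p ∧ D y = 0 := by
    have hle : Subring.closure s ≤ ι.range := by
      rw [Subring.closure_le, hs]
      rintro _ (⟨i, rfl⟩ | ⟨c, -, rfl⟩)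
      · exact ⟨X i, rfl⟩
      · exact ⟨C c, hιC c⟩
    intro y hy
    obtain ⟨p, hp⟩ := hle hy
    refine ⟨p, hp.symm, ?_⟩
    clear hp
    induction hy using Subring.closure_induction with
    | mem y hy =>
      rw [hs] at hy
      rcases hy with ⟨i, rfl⟩ | ⟨c, hc, rfl⟩
      · exact hDX i
      · rw [hDC, hc, map_zero]
    | zero => exact map_zero _
    | one => exact D.map_one_eq_zero
    | add x y _ _ hx hy => rw [map_add, hx, hy, add_zero]
    | neg x _ hx => rw [map_neg, hx, neg_zero]
    | mul x y _ _ hx hy => rw [Derivation.leibniz, hx, hy, smul_zero, smul_zero, add_zero]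
  have hV1 : ∀ y ∈ Subring.closure s, y ≠ 0 → V.valuation y = 1 := by
    intro y hy hy0
    obtain ⟨p, rfl, hDp⟩ := hR y hy
    by_contra hne
    have hlt := lt_of_le_of_ne ((V.valuation_le_one_iff _).mpr (hV.algebraMap_mem p)) hne
    refine hV.not_hasCoverPoint_of_constant (z := Set.range fun i => ι (X i))
      (fun h0 => hy0 (by rw [h0, map_zero])) hlt D hDC hl ?_ hDp ?_ ?_ ?_ h
    · exact fun i => ⟨0, by rw [map_zero, hDX]⟩
    · rintro _ ⟨i, rfl⟩
      exact hV.algebraMap_mem _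
    · rintro _ ⟨i, rfl⟩
      simp [hDX]
    · exact fun i => ⟨_, Algebra.subset_adjoin ⟨i, rfl⟩, by simp [hι]⟩
  have hK1 : ∀ y ∈ Subfield.closure s, y ≠ 0 → V.valuation y = 1 := by
    intro y hy hy0
    obtain ⟨a, ha, b, hb, rfl⟩ := Subfield.mem_closure_iff.mp hy
    rw [map_div₀, hV1 a ha (div_ne_zero_iff.mp hy0).1, hV1 b hb (div_ne_zero_iff.mp hy0).2, div_one]
  have hstable : ∀ y ∈ Subfield.closure s, f.symm y ∈ Subfield.closure s := by
    have hle : Subfield.closure s ≤ (Subfield.closure s).comap (f.symm : K →+* K) := by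
      rw [Subfield.closure_le]
      intro y hy
      have hy' := hy
      rw [hs] at hy
      rcases hy with ⟨i, rfl⟩ | ⟨c, hc, rfl⟩
      · exact hf' i
      · change f.symm (algebraMap ℂ K c) ∈ Subfield.closure s
        rw [AlgEquiv.commutes]
        exact Subfield.subset_closure hy'
    exact fun y hy => hle hy
  refine hV.comap_symm f (fun i => ?_) fun i => ?_
  · refine (V.valuation_le_one_iff _).mp (hK1 _ (hf' i) ?_).le
    rw [map_ne_zero, map_ne_zero_iff _ hinj]
    exact X_ne_zero i
  · obtain ⟨a, ha, b, hb, hab⟩ := Subfield.mem_closure_iff.mp (hf i)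
    obtain ⟨a', rfl, -⟩ := hR a ha
    obtain ⟨b', rfl, -⟩ := hR b hb
    refine ⟨a', b', hK1 _ (hstable _ (Subfield.mem_closure_iff.mpr
      ⟨_, hb, 1, one_mem _, div_one _⟩)) ?_, hab.symm⟩
    rw [map_ne_zero]
    intro h0
    rw [h0, div_zero, eq_comm, map_eq_zero, map_eq_zero_iff _ hinj] at hab
    exact X_ne_zero i hab

end Transport

section Linear

open MvPolynomial

theorem IsPolynomialLocalization.not_hasCoverPoint_of_affine {σ K : Type*} [Fintype σ] [Field K]
    [Algebra ℂ K] [Algebra (MvPolynomial σ ℂ) K] [IsScalarTower ℂ (MvPolynomial σ ℂ) K]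
    [IsFractionRing (MvPolynomial σ ℂ) K] {V : ValuationSubring K}
    (hV : IsPolynomialLocalization σ V) (d : Derivation ℤ ℂ ℂ) {l : ℂ} (hl : d l ≠ 0)
    (b₀ : ℂ) (b : σ → ℂ)
    (h0 : algebraMap ℂ K b₀ +
      ∑ i, algebraMap ℂ K (b i) * algebraMap (MvPolynomial σ ℂ) K (X i) ≠ 0)
    (hlt : V.valuation (algebraMap ℂ K b₀ +
      ∑ i, algebraMap ℂ K (b i) * algebraMap (MvPolynomial σ ℂ) K (X i)) < 1) :
    ¬ HasCoverPoint l V := by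
  classical
  set ι := algebraMap (MvPolynomial σ ℂ) K with hι
  have hιC : ∀ c, ι (C c) = algebraMap ℂ K c := fun c =>
    (IsScalarTower.algebraMap_apply ℂ (MvPolynomial σ ℂ) K c).symm
  have hCV : ∀ c, algebraMap ℂ K c ∈ V := fun c => hιC c ▸ hV.algebraMap_mem _
  have hj : ∃ j, b j ≠ 0 := by
    by_contra! hcon
    simp only [hcon, map_zero, zero_mul, Finset.sum_const_zero, add_zero] at h0 hlt
    exact hlt.ne (algebraMap_valuation_eq_one V hCV fun h => h0 (by rw [h, map_zero]))
  obtain ⟨j, hj⟩ := hj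
  have hj' : algebraMap ℂ K (b j) ≠ 0 := (map_ne_zero _).mpr hj
  let p : MvPolynomial σ ℂ := C b₀ + ∑ i, C (b i) * X i
  have hp : ι p = algebraMap ℂ K b₀ + ∑ i, algebraMap ℂ K (b i) * ι (X i) := by
    simp only [p, map_add, map_sum, map_mul, hιC]
  rw [← hp] at h0 hlt
  let q : MvPolynomial σ ℂ := C (d b₀) + ∑ i, C (d (b i)) * X i
  have hq : ι q = algebraMap ℂ K (d b₀) + ∑ i, algebraMap ℂ K (d (b i)) * ι (X i) := by
    simp only [q, map_add, map_sum, map_mul, hιC]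
  obtain ⟨D, hDC, hDX⟩ := exists_derivation_fractionField (σ := σ) (K := K) d
    fun i => if i = j then ι (- C (b j)⁻¹ * q) else 0
  refine hV.not_hasCoverPoint_of_constant (p := p) (z := (fun i => ι (X i)) '' {i | i ≠ j})
    (fun h => h0 (by rw [h, map_zero])) hlt D hDC hl ?_ ?_ ?_ ?_ ?_
  · intro i
    rw [hDX]
    split_ifs
    · exact ⟨_, rfl⟩
    · exact zero_mem _
  · have hterm : ∀ i, D (algebraMap ℂ K (b i) * ι (X i)) =
        (if i = j then algebraMap ℂ K (b j) * ι (- C (b j)⁻¹ * q) else 0) +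
          algebraMap ℂ K (d (b i)) * ι (X i) := by
      intro i
      rw [Derivation.leibniz, hDC, hDX, smul_eq_mul, smul_eq_mul, mul_comm (ι (X i))]
      split_ifs with h
      · rw [h]
      · rw [mul_zero]
    rw [← hι, hp, map_add, map_sum, hDC, Finset.sum_congr rfl fun i _ => hterm i,
      Finset.sum_add_distrib, Finset.sum_ite_eq' Finset.univ j, if_pos (Finset.mem_univ j),
      map_mul, map_neg, hιC, map_inv₀, hq]
    field_simp
    ring
  · rintro _ ⟨i, -, rfl⟩
    exact hV.algebraMap_mem _
  · rintro _ ⟨i, hi, rfl⟩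
    change V.valuation (D (ι (X i))) < 1
    rw [hDX, if_neg hi, map_zero]
    exact zero_lt_one
  · intro i
    by_cases hi : i = j
    · subst hi
      refine ⟨- algebraMap ℂ K (b i)⁻¹ * (algebraMap ℂ K b₀ +
        ∑ k ∈ Finset.univ.erase i, algebraMap ℂ K (b k) * ι (X k)), ?_, ?_⟩
      · refine mul_mem (neg_mem (Subalgebra.algebraMap_mem _ _))
          (add_mem (Subalgebra.algebraMap_mem _ _) (sum_mem fun k hk => ?_))
        exact mul_mem (Subalgebra.algebraMap_mem _ _)
          (Algebra.subset_adjoin ⟨k, Finset.ne_of_mem_erase hk, rfl⟩)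
      · have h1 : ι p = algebraMap ℂ K (b i) * ι (X i) + (algebraMap ℂ K b₀ +
            ∑ k ∈ Finset.univ.erase i, algebraMap ℂ K (b k) * ι (X k)) := by
          rw [hp, ← Finset.add_sum_erase _ _ (Finset.mem_univ i)]
          ring
        have h2 : ι (X i) - - algebraMap ℂ K (b i)⁻¹ * (algebraMap ℂ K b₀ +
            ∑ k ∈ Finset.univ.erase i, algebraMap ℂ K (b k) * ι (X k)) =
            algebraMap ℂ K (b i)⁻¹ * ι p := by
          rw [h1, map_inv₀]
          field_simp
          ring
        rw [h2, map_mul, mul_comm]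
        exact mul_lt_one_of_lt_of_le hlt ((V.valuation_le_one_iff _).mpr (hCV _))
    · exact ⟨ι (X i), Algebra.subset_adjoin ⟨i, hi, rfl⟩, by
        change V.valuation (ι (X i) - ι (X i)) < 1
        rw [sub_self, map_zero]
        exact zero_lt_one⟩

variable {n : ℕ}

theorem affForm_eq_sum (A : Matrix (Fin (n + 1)) (Fin (n + 1)) ℂ) (r : Fin (n + 1)) :
    affForm n A r =
      ∑ k, algebraMap ℂ (Kn n) (A r k) * Fin.cons (α := fun _ => Kn n) 1 (Xv n) k := by
  rw [Fin.sum_univ_succ, Fin.cons_zero, mul_one]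
  rfl

theorem Xv_ne_zero (i : Fin n) : Xv n i ≠ 0 :=
  (map_ne_zero_iff _ (FaithfulSMul.algebraMap_injective _ _)).mpr (X_ne_zero i)

/-- The inverse of a linear automorphism is given by the inverse matrix. -/
theorem exists_matrix_symm (hn : 0 < n) {f : CremonaN n}
    {A : Matrix (Fin (n + 1)) (Fin (n + 1)) ℂ} (hA : IsUnit A)
    (hf : ∀ i : Fin n, f (Xv n i) = affForm n A i.succ / affForm n A 0) :
    ∃ B : Matrix (Fin (n + 1)) (Fin (n + 1)) ℂ, IsUnit B ∧
      affForm n B 0 * f.symm (affForm n A 0) = 1 ∧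
      ∀ i : Fin n, f.symm (Xv n i) = affForm n B i.succ / affForm n B 0 := by
  obtain ⟨u, rfl⟩ := hA
  set A : Matrix (Fin (n + 1)) (Fin (n + 1)) ℂ := u.val
  set B : Matrix (Fin (n + 1)) (Fin (n + 1)) ℂ := u⁻¹.val
  have hBA : B * A = 1 := u.inv_mul
  have hA0 : affForm n A 0 ≠ 0 := fun h => by
    have h1 := hf ⟨0, hn⟩
    rw [h, div_zero, map_eq_zero] at h1
    exact Xv_ne_zero _ h1
  let x : Fin (n + 1) → Kn n := Fin.cons 1 (Xv n)
  have hx : ∀ i, f (x i) * affForm n A 0 = affForm n A i := by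
    intro i
    refine Fin.cases ?_ (fun i => ?_) i
    · simp [x]
    · simp only [x, Fin.cons_succ]
      rw [hf, div_mul_cancel₀ _ hA0]
  have hx' : ∀ i, x i * f.symm (affForm n A 0) =
      ∑ k, algebraMap ℂ (Kn n) (A i k) * f.symm (x k) := by
    intro i
    have h := congrArg f.symm (hx i)
    rw [map_mul, f.symm_apply_apply, affForm_eq_sum A i, map_sum] at h
    rw [h]
    refine Finset.sum_congr rfl fun k _ => ?_
    rw [map_mul, AlgEquiv.commutes]
  have hB : ∀ r, affForm n B r * f.symm (affForm n A 0) = f.symm (x r) := by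
    intro r
    have h1 : ∀ k, ∑ i, algebraMap ℂ (Kn n) (B r i) * algebraMap ℂ (Kn n) (A i k) =
        algebraMap ℂ (Kn n) ((1 : Matrix (Fin (n + 1)) (Fin (n + 1)) ℂ) r k) := by
      intro k
      rw [← hBA, Matrix.mul_apply, map_sum]
      exact Finset.sum_congr rfl fun i _ => (map_mul _ _ _).symm
    calc affForm n B r * f.symm (affForm n A 0)
        = ∑ i, algebraMap ℂ (Kn n) (B r i) * (x i * f.symm (affForm n A 0)) := by
          rw [affForm_eq_sum, Finset.sum_mul]
          exact Finset.sum_congr rfl fun i _ => mul_assoc _ _ _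
      _ = ∑ i, ∑ k, algebraMap ℂ (Kn n) (B r i) * algebraMap ℂ (Kn n) (A i k) * f.symm (x k) := by
          refine Finset.sum_congr rfl fun i _ => ?_
          rw [hx', Finset.mul_sum]
          exact Finset.sum_congr rfl fun k _ => (mul_assoc _ _ _).symm
      _ = ∑ k, algebraMap ℂ (Kn n) ((1 : Matrix (Fin (n + 1)) (Fin (n + 1)) ℂ) r k) *
            f.symm (x k) := by
          rw [Finset.sum_comm]
          refine Finset.sum_congr rfl fun k _ => ?_
          rw [← Finset.sum_mul, h1]
      _ = f.symm (x r) := by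
          rw [Finset.sum_eq_single r]
          · rw [Matrix.one_apply_eq, map_one, one_mul]
          · intro k _ hk
            rw [Matrix.one_apply_ne hk.symm, map_zero, zero_mul]
          · intro h
            exact absurd (Finset.mem_univ r) h
  have hB0 : affForm n B 0 * f.symm (affForm n A 0) = 1 := by
    rw [hB]
    simp [x]
  refine ⟨B, (u⁻¹).isUnit, hB0, fun i => ?_⟩
  rw [eq_div_iff (left_ne_zero_of_mul_eq_one hB0)]
  have h : f.symm (Xv n i) = affForm n B i.succ * f.symm (affForm n A 0) := (hB i.succ).symm
  rw [h, mul_assoc, mul_comm (f.symm _), hB0, mul_one]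

theorem IsLinearAutN.symm (hn : 0 < n) {f : CremonaN n} (hf : IsLinearAutN n f) :
    IsLinearAutN n f.symm := by
  obtain ⟨A, hA, hfA⟩ := hf
  obtain ⟨B, hB, -, hfB⟩ := exists_matrix_symm hn hA hfA
  exact ⟨B, hB, hfB⟩

theorem algebraMap_C (c : ℂ) :
    algebraMap (MvPolynomial (Fin n) ℂ) (Kn n) (C c) = algebraMap ℂ (Kn n) c :=
  (IsScalarTower.algebraMap_apply ℂ (MvPolynomial (Fin n) ℂ) (Kn n) c).symm

theorem algebraMap_affine (A : Matrix (Fin (n + 1)) (Fin (n + 1)) ℂ) (r : Fin (n + 1)) :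
    algebraMap (MvPolynomial (Fin n) ℂ) (Kn n) (C (A r 0) + ∑ j : Fin n, C (A r j.succ) * X j) =
      affForm n A r := by
  simp only [map_add, map_sum, map_mul, algebraMap_C]
  rfl

theorem IsLinearAutN.comap_symm (hn : 0 < n) {f : CremonaN n} (hf : IsLinearAutN n f)
    (d : Derivation ℤ ℂ ℂ) {l : ℂ} (hl : d l ≠ 0) {V : ValuationSubring (Kn n)}
    (hV : IsPolynomialLocalization (Fin n) V) (h : HasCoverPoint l V) :
    IsPolynomialLocalization (Fin n) (V.comap (f.symm : Kn n →+* Kn n)) := by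
  obtain ⟨A, hA, hfA⟩ := hf
  obtain ⟨B, hB, hAB, hfB⟩ := exists_matrix_symm hn hA hfA
  have hmem : ∀ r, affForm n B r ∈ V := fun r => algebraMap_affine B r ▸ hV.algebraMap_mem _
  have hB1 : V.valuation (affForm n B 0) = 1 := by
    by_contra hne
    exact hV.not_hasCoverPoint_of_affine d hl (B 0 0) (fun j => B 0 j.succ)
      (left_ne_zero_of_mul_eq_one hAB)
      (lt_of_le_of_ne ((V.valuation_le_one_iff _).mpr (hmem 0)) hne) h
  refine hV.comap_symm f (fun i => ?_) fun i => ?_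
  · change f.symm (Xv n i) ∈ V
    rw [hfB, div_eq_mul_inv]
    exact mul_mem (hmem _) (inv_mem_of_valuation_eq_one V hB1)
  · refine ⟨_, _, ?_, ((hfA i).trans
      (congrArg₂ _ (algebraMap_affine A _).symm (algebraMap_affine A _).symm))⟩
    rw [algebraMap_affine]
    have h1 := congrArg V.valuation hAB
    rwa [map_mul, hB1, one_mul, map_one] at h1

end Linear

section Existence

open MvPolynomial

theorem irreducible_X_sub_C {σ k : Type*} [Field k] (i : σ) (c : k) :
    Irreducible (X i - C c : MvPolynomial σ k) := by
  classical
  have hcoeff : (X i - C c : MvPolynomial σ k).coeff (Finsupp.single i 1) = 1 := by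
    rw [coeff_sub, coeff_C, if_neg (Finsupp.single_ne_zero.mpr one_ne_zero).symm, sub_zero,
      coeff_X, if_pos rfl]
  refine irreducible_of_totalDegree_eq_one (le_antisymm ?_ ?_) fun x hx => ?_
  · refine (totalDegree_sub _ _).trans ?_
    simp
  · rw [← not_lt, Nat.lt_one_iff, totalDegree_eq_zero_iff]
    intro h
    have h1 := h (Finsupp.single i 1) (by rw [mem_support_iff, hcoeff]; exact one_ne_zero) i
    simp at h1
  · exact isUnit_of_dvd_one (hcoeff ▸ hx (Finsupp.single i 1))

/-- The localization of a factorial ring at a prime element is a valuation ring. -/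
theorem exists_valuationSubring_of_prime {A K : Type*} [CommRing A] [IsDomain A]
    [UniqueFactorizationMonoid A] [Field K] [Algebra A K] [IsFractionRing A K] {q : A}
    (hq : Prime q) :
    ∃ V : ValuationSubring K, (∀ a, algebraMap A K a ∈ V) ∧ V.valuation (algebraMap A K q) < 1 ∧
      ∀ z ∈ V, ∃ a b, V.valuation (algebraMap A K b) = 1 ∧
        z = algebraMap A K a / algebraMap A K b := by
  have hinj : Function.Injective (algebraMap A K) := FaithfulSMul.algebraMap_injective A K
  have hne : ∀ b, ¬ q ∣ b → algebraMap A K b ≠ 0 := fun b hb h =>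
    hb ((map_eq_zero_iff _ hinj).mp h ▸ dvd_zero q)
  have hmul : ∀ {b c}, ¬ q ∣ b → ¬ q ∣ c → ¬ q ∣ b * c := fun hb hc h =>
    (hq.dvd_or_dvd h).elim hb hc
  let R : Subring K :=
    { carrier := {z | ∃ a b, ¬ q ∣ b ∧ z = algebraMap A K a / algebraMap A K b}
      mul_mem' := by
        rintro _ _ ⟨a, b, hb, rfl⟩ ⟨c, e, he, rfl⟩
        exact ⟨a * c, b * e, hmul hb he, by rw [map_mul, map_mul, div_mul_div_comm]⟩
      one_mem' := ⟨1, 1, hq.not_dvd_one, by simp⟩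
      add_mem' := by
        rintro _ _ ⟨a, b, hb, rfl⟩ ⟨c, e, he, rfl⟩
        exact ⟨a * e + b * c, b * e, hmul hb he, by
          rw [div_add_div _ _ (hne b hb) (hne e he), map_add, map_mul, map_mul, map_mul]⟩
      zero_mem' := ⟨0, 1, hq.not_dvd_one, by simp⟩
      neg_mem' := by
        rintro _ ⟨a, b, hb, rfl⟩
        exact ⟨-a, b, hb, by rw [map_neg, neg_div]⟩ }
  have hR : ∀ x : K, x ∈ R ∨ x⁻¹ ∈ R := by
    intro x
    obtain ⟨a, b, hab, rfl⟩ := IsFractionRing.exists_reduced_fraction A x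
    rw [IsFractionRing.mk'_eq_div]
    by_cases hb : q ∣ b
    · exact Or.inr ⟨b, a, fun ha => hq.not_isUnit (hab ha hb), inv_div _ _⟩
    · exact Or.inl ⟨a, b, hb, rfl⟩
  let V := ValuationSubring.ofSubring R hR
  have hA : ∀ a, algebraMap A K a ∈ V := fun a => ⟨a, 1, hq.not_dvd_one, by simp⟩
  refine ⟨V, hA, ?_, ?_⟩
  · rw [valuation_lt_one_iff_inv_notMem]
    refine Or.inr ?_
    rintro ⟨a, b, hb, hab⟩
    rw [inv_eq_one_div, div_eq_div_iff ((map_ne_zero_iff _ hinj).mpr hq.ne_zero) (hne b hb),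
      one_mul, ← map_mul] at hab
    exact hb ⟨a, by rw [hinj hab, mul_comm]⟩
  · rintro z ⟨a, b, hb, rfl⟩
    refine ⟨a, b, (valuation_eq_one_iff_mem V).mpr ⟨hA b, ?_⟩, rfl⟩
    rw [valuation_lt_one_iff_inv_notMem, not_or, not_not]
    exact ⟨hne b hb, 1, b, hb, by rw [map_one, one_div]⟩

/-- The automorphism `x_j ↦ x_j p` of the field of rational functions, where the polynomial `p`
does not involve `x_j`. -/
theorem exists_algEquiv_mul {σ k K : Type*} [DecidableEq σ] [Field k] [Field K] [Algebra k K]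
    [Algebra (MvPolynomial σ k) K] [IsScalarTower k (MvPolynomial σ k) K]
    [IsFractionRing (MvPolynomial σ k) K] (j : σ) {p : MvPolynomial σ k} (hp : p ≠ 0)
    (hpj : j ∉ p.vars) :
    ∃ f : K ≃ₐ[k] K, (∀ a, j ∉ a.vars →
        f (algebraMap (MvPolynomial σ k) K a) = algebraMap (MvPolynomial σ k) K a) ∧
      f (algebraMap (MvPolynomial σ k) K (X j)) =
        algebraMap (MvPolynomial σ k) K (X j) * algebraMap (MvPolynomial σ k) K p := by
  set ι := algebraMap (MvPolynomial σ k) K with hι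
  have hinj : Function.Injective ι := FaithfulSMul.algebraMap_injective _ _
  let ιA : MvPolynomial σ k →ₐ[k] K := IsScalarTower.toAlgHom k (MvPolynomial σ k) K
  have hp' : ι p ≠ 0 := (map_ne_zero_iff _ hinj).mpr hp
  have hfix : ∀ (g : σ → K), (∀ i, i ≠ j → g i = ι (X i)) → ∀ a : MvPolynomial σ k, j ∉ a.vars →
      aeval g a = ι a := by
    intro g hg a ha
    have h1 : ι a = aeval (fun i => ι (X i)) a := by
      have : ιA = aeval (fun i => ι (X i)) := by
        ext i
        rw [aeval_X]
        rfl
      exact congrArg (fun φ => φ a) this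
    rw [h1]
    refine eval₂Hom_congr' rfl (fun i hi _ => ?_) rfl
    exact hg i fun h => ha (h ▸ hi)
  let g : σ → MvPolynomial σ k := fun i => if i = j then X j * p else X i
  let φ : MvPolynomial σ k →ₐ[k] MvPolynomial σ k := aeval g
  have hφX : φ (X j) = X j * p := by simp [φ, g]
  have hφ : ∀ a, j ∉ a.vars → ι (φ a) = ι a := by
    intro a ha
    have h1 : ι (φ a) = aeval (fun i => ι (g i)) a := by
      have : ιA.comp φ = aeval (fun i => ι (g i)) := by
        ext i
        simp only [AlgHom.comp_apply, φ, aeval_X]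
        rfl
      exact congrArg (fun φ => φ a) this
    rw [h1]
    exact hfix _ (fun i hi => by simp only [g]; rw [if_neg hi]) a ha
  let h : σ → K := fun i => if i = j then ι (X j) / ι p else ι (X i)
  have hh : ∀ a, j ∉ a.vars → aeval h a = ι a := hfix h fun i hi => by simp only [h]; rw [if_neg hi]
  have hcomp : (aeval h : MvPolynomial σ k →ₐ[k] K).comp φ = ιA := by
    ext i
    rw [AlgHom.comp_apply]
    by_cases hi : i = j
    · subst hi
      rw [hφX, map_mul, hh p hpj, aeval_X]
      simp only [h, if_true]
      rw [div_mul_cancel₀ _ hp']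
      rfl
    · simp only [φ, aeval_X, g]
      rw [if_neg hi, aeval_X]
      simp only [h]
      rw [if_neg hi]
      rfl
  have hφinj : Function.Injective (ιA.comp φ) := by
    have h1 : Function.Injective φ := by
      have h2 : Function.Injective ((aeval h : MvPolynomial σ k →ₐ[k] K) ∘ φ) := by
        rw [← AlgHom.coe_comp, hcomp]
        exact hinj
      exact Function.Injective.of_comp h2
    exact hinj.comp h1
  let F : K →ₐ[k] K := IsFractionRing.liftAlgHom hφinj
  have hF : ∀ a, F (ι a) = ι (φ a) := fun a => IsFractionRing.lift_algebraMap hφinj a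
  have hX : ∀ i, ι (X i) ∈ F.fieldRange := by
    intro i
    by_cases hi : i = j
    · subst hi
      have h1 : ι (X i) = F (ι (X i)) / F (ι p) := by
        rw [hF, hF, hφX, hφ p hpj, map_mul, mul_div_cancel_right₀ _ hp']
      rw [h1, ← map_div₀]
      exact ⟨_, rfl⟩
    · refine ⟨ι (X i), ?_⟩
      change F (ι (X i)) = _
      rw [hF, hφ]
      rw [vars_X]
      simpa using Ne.symm hi
  have hA : ∀ a, ι a ∈ F.fieldRange := by
    intro a
    induction a using MvPolynomial.induction_on with
    | C c =>
      have : ι (C c) = algebraMap k K c :=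
        (IsScalarTower.algebraMap_apply k (MvPolynomial σ k) K c).symm
      rw [this]
      exact IntermediateField.algebraMap_mem _ c
    | add p q hp hq => rw [map_add]; exact add_mem hp hq
    | mul_X p i hp => rw [map_mul]; exact mul_mem hp (hX i)
  have hsurj : Function.Surjective F := by
    intro y
    obtain ⟨a, b, -, rfl⟩ := IsFractionRing.div_surjective (A := MvPolynomial σ k) y
    exact div_mem (hA a) (hA b)
  refine ⟨AlgEquiv.ofBijective F ⟨F.injective, hsurj⟩, fun a ha => (hF a).trans (hφ a ha), ?_⟩
  exact (hF _).trans (by rw [hφX, map_mul])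

end Existence

section Main

open MvPolynomial

/-- A rational function lies in the field generated by the variables and a set of constants which
contains its countably many coefficients. -/
theorem exists_countable_mem_closure {σ K : Type*} [Field K] [Algebra ℂ K]
    [Algebra (MvPolynomial σ ℂ) K] [IsScalarTower ℂ (MvPolynomial σ ℂ) K]
    [IsFractionRing (MvPolynomial σ ℂ) K] (y : K) :
    ∃ T : Set ℂ, T.Countable ∧ ∀ Z : Set ℂ, T ⊆ Z →
      y ∈ Subfield.closure (Set.range (fun i => algebraMap (MvPolynomial σ ℂ) K (X i)) ∪
        algebraMap ℂ K '' Z) := by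
  obtain ⟨a, b, -, rfl⟩ := IsFractionRing.div_surjective (A := MvPolynomial σ ℂ) y
  have key : ∀ (p : MvPolynomial σ ℂ) (Z : Set ℂ), Set.range p.coeff ⊆ Z →
      algebraMap (MvPolynomial σ ℂ) K p ∈ Subfield.closure
        (Set.range (fun i => algebraMap (MvPolynomial σ ℂ) K (X i)) ∪ algebraMap ℂ K '' Z) := by
    intro p Z hZ
    rw [p.as_sum, map_sum]
    refine sum_mem fun m _ => ?_
    rw [monomial_eq, map_mul, Finsupp.prod, map_prod]
    refine mul_mem ?_ (prod_mem fun i _ => ?_)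
    · rw [← algebraMap_eq, ← IsScalarTower.algebraMap_apply]
      exact Subfield.subset_closure (Or.inr ⟨_, hZ ⟨m, rfl⟩, rfl⟩)
    · rw [map_pow]
      refine pow_mem ?_ _
      exact Subfield.subset_closure (Or.inl ⟨i, rfl⟩)
  have hc : ∀ p : MvPolynomial σ ℂ, (Set.range p.coeff).Countable := fun p => by
    have h : Set.range p.coeff ⊆ insert 0 (p.coeff '' p.support) := by
      rintro _ ⟨m, rfl⟩
      by_cases hm : p.coeff m = 0
      · exact Or.inl hm
      · exact Or.inr ⟨m, mem_support_iff.mpr hm, rfl⟩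
    exact ((p.support.countable_toSet.image _).insert 0).mono h
  exact ⟨_, (hc a).union (hc b), fun Z hZ => div_mem
    (key a Z (Set.subset_union_left.trans hZ)) (key b Z (Set.subset_union_right.trans hZ))⟩

theorem exists_pow_four_ne (c : ℂ) : ∃ y : ℂ, c + y ^ 4 ≠ 1 := by
  by_cases h : c = 1
  · exact ⟨1, by simp [h]⟩
  · exact ⟨0, by simpa using h⟩

/-- The equation in `x_i` and `x_j` of a double cover of the Fermat quartic curve. -/
def coverPoly {σ : Type*} (l : ℂ) (i j : σ) : MvPolynomial σ ℂ :=
  (X i ^ 2 + C l) ^ 4 + X j ^ 4 - 1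

section coverPoly

variable {σ : Type*} (l : ℂ) {i j : σ}

theorem eval_coverPoly (g : σ → ℂ) :
    eval g (coverPoly l i j) = (g i ^ 2 + l) ^ 4 + g j ^ 4 - 1 := by
  simp [coverPoly]

theorem exists_eval_coverPoly_ne_zero (hij : i ≠ j) (α : ℂ) :
    ∃ g : σ → ℂ, g i = α ∧ (∀ k, k ≠ i → k ≠ j → g k = 0) ∧ eval g (coverPoly l i j) ≠ 0 := by
  classical
  obtain ⟨y, hy⟩ := exists_pow_four_ne ((α ^ 2 + l) ^ 4)
  refine ⟨Function.update (Function.update 0 j y) i α, by simp, fun k hi hj => by simp [hi, hj], ?_⟩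
  rw [eval_coverPoly, Function.update_self, Function.update_of_ne hij.symm, Function.update_self]
  exact sub_ne_zero.mpr hy

theorem coverPoly_ne_zero (hij : i ≠ j) : coverPoly l i j ≠ 0 := by
  obtain ⟨g, -, -, h⟩ := exists_eval_coverPoly_ne_zero l hij 0
  exact fun h0 => h (by rw [h0, map_zero])

theorem not_isUnit_coverPoly (hij : i ≠ j) : ¬ IsUnit (coverPoly l i j) := by
  classical
  intro h
  obtain ⟨y, hy⟩ := IsAlgClosed.exists_pow_nat_eq (1 - l ^ 4) (n := 4) (by norm_num)
  refine (h.map (eval (Function.update 0 j y : σ → ℂ))).ne_zero ?_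
  rw [eval_coverPoly, Function.update_self, Function.update_of_ne hij, hy]
  simp

theorem not_X_sub_C_dvd_coverPoly (hij : i ≠ j) (α : ℂ) : ¬ X i - C α ∣ coverPoly l i j := by
  rintro ⟨p, hp⟩
  obtain ⟨g, hi, -, h⟩ := exists_eval_coverPoly_ne_zero l hij α
  exact h (by rw [hp, map_mul, map_sub, eval_X, eval_C, hi, sub_self, zero_mul])

theorem not_X_dvd_coverPoly (hij : i ≠ j) {k : σ} (hki : k ≠ i) (hkj : k ≠ j) :
    ¬ X k ∣ coverPoly l i j := by
  rintro ⟨p, hp⟩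
  obtain ⟨g, -, hk, h⟩ := exists_eval_coverPoly_ne_zero l hij 0
  exact h (by rw [hp, map_mul, eval_X, hk k hki hkj, zero_mul])

theorem notMem_vars_coverPoly {k : σ} (hki : k ≠ i) (hkj : k ≠ j) :
    k ∉ (coverPoly l i j).vars := by
  classical
  intro hk
  have h : (coverPoly l i j).vars ⊆ {i, j} := by
    have hX : ∀ (m : σ) (r : ℕ), (X m ^ r : MvPolynomial σ ℂ).vars ⊆ {m} := fun m r =>
      (vars_pow _ _).trans (by rw [vars_X])
    refine (vars_sub_subset _).trans (Finset.union_subset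
      ((vars_add_subset _ _).trans (Finset.union_subset ((vars_pow _ _).trans
        ((vars_add_subset _ _).trans (Finset.union_subset ((hX _ _).trans ?_) ?_)))
        ((hX _ _).trans ?_))) ?_) <;> simp
  simpa [hki, hkj] using h hk

variable (K : Type*) [Field K] [Algebra ℂ K] [Algebra (MvPolynomial σ ℂ) K]
  [IsScalarTower ℂ (MvPolynomial σ ℂ) K] [IsFractionRing (MvPolynomial σ ℂ) K]

theorem exists_hasCoverPoint (hij : i ≠ j) : ∃ V : ValuationSubring K,
    IsPolynomialLocalization σ V ∧ HasCoverPoint l V ∧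
      V.valuation (algebraMap (MvPolynomial σ ℂ) K (coverPoly l i j)) < 1 := by
  obtain ⟨q, hq, hqp⟩ := WfDvdMonoid.exists_irreducible_factor (not_isUnit_coverPoly l hij)
    (coverPoly_ne_zero l hij)
  have hq := hq.prime
  obtain ⟨V, hA, hqV, hdiv⟩ := exists_valuationSubring_of_prime (K := K) hq
  have hV : IsPolynomialLocalization σ V := ⟨hA, hdiv⟩
  have hpV : V.valuation (algebraMap (MvPolynomial σ ℂ) K (coverPoly l i j)) < 1 := by
    obtain ⟨c, hc⟩ := hqp
    rw [hc, map_mul, map_mul]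
    exact mul_lt_one_of_lt_of_le hqV ((V.valuation_le_one_iff _).mpr (hA c))
  refine ⟨V, hV, ⟨algebraMap _ K (X i ^ 2 + C l), hA _, algebraMap _ K (X j), hA _,
    algebraMap _ K (X i), hA _, ?_, ?_, fun c hc => ?_⟩, hpV⟩
  · simpa [coverPoly] using hpV
  · rw [IsScalarTower.algebraMap_apply ℂ (MvPolynomial σ ℂ) K, ← map_sub, ← map_pow, ← map_sub,
      algebraMap_eq, add_sub_cancel_right, sub_self]
    simp
  · rw [IsScalarTower.algebraMap_apply ℂ (MvPolynomial σ ℂ) K, ← map_sub] at hc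
    have h1 := hV.dvd_of_valuation_lt_one hq hqV hc
    obtain ⟨α, hα⟩ := IsAlgClosed.exists_pow_nat_eq (c - l) (n := 2) (by norm_num)
    have h2 : (X i ^ 2 + C l - algebraMap ℂ (MvPolynomial σ ℂ) c) =
        (X i - C α) * (X i - C (-α)) := by
      rw [algebraMap_eq, show c = α ^ 2 + l by rw [hα, sub_add_cancel], C_add, C_pow, C_neg]
      ring
    rw [h2] at h1
    have h3 : ∀ β, ¬ q ∣ X i - C β := fun β hβ =>
      not_X_sub_C_dvd_coverPoly l hij β
        ((hq.irreducible.dvd_symm (irreducible_X_sub_C i β) hβ).trans hqp)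
    exact (hq.dvd_or_dvd h1).elim (h3 _) (h3 _)

end coverPoly

/-- An automorphism which preserves the localizations of `ℂ[x]` whose residue field contains a
point of the double cover. -/
def PreservesCoverPoint (n : ℕ) (l : ℂ) (f : CremonaN n) : Prop :=
  ∀ V : ValuationSubring (Kn n), IsPolynomialLocalization (Fin n) V → HasCoverPoint l V →
    IsPolynomialLocalization (Fin n) (V.comap (f.symm : Kn n →+* Kn n))

theorem PreservesCoverPoint.mul {n : ℕ} {l : ℂ} {f g : CremonaN n}
    (hf : PreservesCoverPoint n l f) (hg : PreservesCoverPoint n l g) :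
    PreservesCoverPoint n l (f * g) := fun V hV h =>
  hf (V.comap (g.symm : Kn n →+* Kn n)) (hg V hV h) (h.comap g.symm)

theorem not_forall_preservesCoverPoint {n : ℕ} (hn : 3 ≤ n) (l : ℂ) :
    ∃ f, ¬ PreservesCoverPoint n l f := by
  let i : Fin n := ⟨0, by omega⟩
  let j : Fin n := ⟨1, by omega⟩
  let k : Fin n := ⟨2, by omega⟩
  have hij : i ≠ j := by simp [i, j]
  have hki : k ≠ i := by simp [i, k]
  have hkj : k ≠ j := by simp [j, k]
  obtain ⟨V, hV, h, hpV⟩ := exists_hasCoverPoint l (Kn n) hij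
  obtain ⟨f, hf, hfk⟩ := exists_algEquiv_mul (K := Kn n) k (coverPoly_ne_zero l hij)
    (notMem_vars_coverPoly l hki hkj)
  refine ⟨f.symm, fun hP => not_X_dvd_coverPoly l hij hki hkj
    ((hP V hV h).dvd_of_valuation_lt_one X_prime ?_ ?_)⟩
  · rw [valuation_comap_lt_one_iff]
    change V.valuation (f _) < 1
    rw [hfk, mul_comm, map_mul]
    exact mul_lt_one_of_lt_of_le hpV ((V.valuation_le_one_iff _).mpr (hV.algebraMap_mem _))
  · rw [valuation_comap_lt_one_iff]
    change V.valuation (f _) < 1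
    rwa [hf _ (notMem_vars_coverPoly l hki hkj)]

theorem not_countable_setOf_not_isLinearAutN {n : ℕ} (hn : 3 ≤ n) {S : Set (CremonaN n)}
    (hS : Subgroup.closure S = ⊤) : ¬ ({f ∈ S | ¬ IsLinearAutN n f}).Countable := by
  intro hcount
  choose T hT hTmem using exists_countable_mem_closure (σ := Fin n) (K := Kn n)
  let ι := algebraMap (MvPolynomial (Fin n) ℂ) (Kn n)
  let B : Set ℂ := ⋃ f ∈ {f ∈ S | ¬ IsLinearAutN n f}, ⋃ i : Fin n,
    T (f (ι (X i))) ∪ T (f.symm (ι (X i)))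
  have hB : B.Countable := hcount.biUnion fun f _ => Set.countable_iUnion fun i =>
    (hT _).union (hT _)
  obtain ⟨d, hd, l, hl⟩ := exists_derivation_complex hB
  obtain ⟨D, hDC, hDX⟩ := exists_derivation_fractionField (σ := Fin n) (K := Kn n) d fun _ => 0
  have key : ∀ f ∈ S, PreservesCoverPoint n l f ∧ PreservesCoverPoint n l f⁻¹ := by
    intro f hf
    by_cases hlin : IsLinearAutN n f
    · exact ⟨fun V => IsLinearAutN.comap_symm (by omega) hlin d hl,
        fun V => IsLinearAutN.comap_symm (by omega) (IsLinearAutN.symm (by omega) hlin) d hl⟩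
    · have hsub : ∀ i, T (f (ι (X i))) ∪ T (f.symm (ι (X i))) ⊆ {c | d c = 0} := fun i c hc =>
        hd c (Set.mem_biUnion (show f ∈ {f ∈ S | ¬ IsLinearAutN n f} from ⟨hf, hlin⟩)
          (Set.mem_iUnion.mpr ⟨i, hc⟩))
      have h1 := fun i => hTmem _ _ (Set.subset_union_left.trans (hsub i))
      have h2 := fun i => hTmem _ _ (Set.subset_union_right.trans (hsub i))
      exact ⟨fun V hV h => hV.comap_symm_of_mem_closure D hDC hl hDX h f rfl h1 h2,
        fun V hV h => hV.comap_symm_of_mem_closure D hDC hl hDX h f.symm rfl h2 h1⟩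
  have hall : ∀ g ∈ Subgroup.closure S,
      PreservesCoverPoint n l g ∧ PreservesCoverPoint n l g⁻¹ := by
    intro g hg
    induction hg using Subgroup.closure_induction with
    | mem f hf => exact key f hf
    | one => exact ⟨fun V hV _ => hV, fun V hV _ => hV⟩
    | mul f g _ _ hf hg => exact ⟨hf.1.mul hg.1, by rw [mul_inv_rev]; exact hg.2.mul hf.2⟩
    | inv f _ hf => exact ⟨hf.2, by rw [inv_inv]; exact hf.1⟩
  obtain ⟨g, hg⟩ := not_forall_preservesCoverPoint hn l
  exact hg (hall g (hS ▸ Subgroup.mem_top g)).1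

end Main

end HudsonPan

/-- **Theorem of Hudson and Pan.** For `n ≥ 3`, every set of group generators of the Cremona
group `Bir(ℙⁿ_ℂ)` contains uncountably many elements that are not linear automorphisms. -/
theorem hudson_pan (n : ℕ) (hn : 3 ≤ n) (S : Set (CremonaN n))
    (hS : Subgroup.closure S = ⊤) :
    ¬ ({f ∈ S | ¬ IsLinearAutN n f}).Countable := by
  exact HudsonPan.not_countable_setOf_not_isLinearAutN hn hS
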